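/- arXiv:1702.06419 — 3 statements merged into one kernel-verified Lean document; each statement's English description precedes it below -/
import Mathlib

section
/- Let p be a prime, A ⊆ F_p with A ∩ (-A) = ∅, and α an integer with 0 ≤ α ≤ |A|. Then |Σ_α(A)| ≥ min{p, |A|(|A|+1)/2 - α(α+1)/2 + 1}, where Σ_α(A) is the set of sums of at least α pairwise distinct elements of A. -/
/-- `SigmaGe A α` is `Σ_α(A)`, the set of sums of at least `α` pairwise distinct
elements of `A`. -/
def SigmaGe {M : Type*} [AddCommMonoid M] [DecidableEq M] (A : Finset M) (α : ℕ) : Finset M :=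
  ((A.powerset.filter fun S => α ≤ S.card)).image fun S => S.sum id

open Finset MvPolynomial in
/-- The coefficient formula: a coefficient of top degree is a weighted sum of values over a grid. -/
theorem sum_piFinset_eval_mul_prod_nodalWeight {σ F : Type*} [Fintype σ] [DecidableEq σ] [Field F]
    [DecidableEq F] (C : σ → Finset F) (hC : ∀ i, (C i).Nonempty) (P : MvPolynomial σ F)
    (hP : P.totalDegree ≤ ∑ i, (#(C i) - 1)) :
    ∑ x ∈ Fintype.piFinset C, eval x P * ∏ i, Lagrange.nodalWeight (C i) id (x i) =
      coeff (Finsupp.equivFunOnFinite.symm fun i => #(C i) - 1) P := by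
  have key : ∀ (s : Finset F) (k : ℕ), k < #s →
      ∑ x ∈ s, x ^ k * Lagrange.nodalWeight s id x = if k = #s - 1 then 1 else 0 := by
    intro s k hk
    have h := Lagrange.coeff_eq_sum (s := s) (v := id) Function.injective_id.injOn
      (P := (Polynomial.X : Polynomial F) ^ k)
      (by rw [Polynomial.degree_X_pow]; exact_mod_cast hk)
    rw [Polynomial.coeff_X_pow] at h
    simp only [eq_comm (a := k), h, Polynomial.eval_pow, Polynomial.eval_X]
    refine sum_congr rfl fun x _ => ?_
    simp [Lagrange.nodalWeight, div_eq_mul_inv, prod_inv_distrib]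
  set c : σ →₀ ℕ := Finsupp.equivFunOnFinite.symm fun i => #(C i) - 1 with hc
  have hmono : ∀ m ∈ P.support,
      ∑ x ∈ Fintype.piFinset C, (∏ i, x i ^ m i) * ∏ i, Lagrange.nodalWeight (C i) id (x i) =
        if m = c then 1 else 0 := by
    intro m hm
    simp only [← prod_mul_distrib]
    rw [← prod_univ_sum C (fun i t => t ^ m i * Lagrange.nodalWeight (C i) id t)]
    split_ifs with h
    · refine prod_eq_one fun i _ => ?_
      have : m i = #(C i) - 1 := by rw [h]; simp [hc]
      rw [key _ _ (by have := (hC i).card_pos; omega), if_pos this]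
    · obtain ⟨i, hi⟩ : ∃ i, m i < #(C i) - 1 := by
        by_contra! hge
        refine h (Finsupp.ext fun i => ?_)
        have hle : ∑ i, m i ≤ ∑ i, (#(C i) - 1) := by
          refine le_trans ?_ hP
          have := le_totalDegree hm
          rwa [Finsupp.sum_fintype _ _ (fun _ => rfl)] at this
        have heq := (sum_eq_sum_iff_of_le fun i _ => hge i).1
          (le_antisymm (sum_le_sum fun i _ => hge i) hle) i (mem_univ i)
        simp [hc, ← heq]
      refine prod_eq_zero (mem_univ i) ?_
      rw [key _ _ (by omega), if_neg hi.ne]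
  simp only [eval_eq', sum_mul]
  rw [sum_comm]
  calc _ = ∑ m ∈ P.support, coeff m P * if m = c then 1 else 0 := by
        refine sum_congr rfl fun m hm => ?_
        rw [← hmono m hm, mul_sum]
        simp only [mul_assoc]
    _ = coeff c P := by
        simp only [mul_ite, mul_one, mul_zero, sum_ite_eq', mem_support_iff, ite_not]
        split_ifs with h
        · exact h.symm
        · rfl

open Finset MvPolynomial in
theorem totalDegree_mul_prod_sub_C_le {σ F : Type*} [Field F] (Q S : MvPolynomial σ F)
    (hS : S.totalDegree ≤ 1) (T : Finset F) :
    (Q * ∏ t ∈ T, (S - C t)).totalDegree ≤ Q.totalDegree + #T := by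
  refine (totalDegree_mul _ _).trans (Nat.add_le_add_left ?_ _)
  refine (totalDegree_finsetProd _ _).trans ?_
  refine (sum_le_card_nsmul _ _ 1 fun t _ => ?_).trans (by simp)
  exact (totalDegree_sub_C_le _ _).trans hS

open Finset MvPolynomial in
theorem coeff_mul_prod_sub_C {σ F : Type*} [Fintype σ] [Field F] [DecidableEq F]
    (Q S : MvPolynomial σ F) (hS : S.totalDegree ≤ 1) (T : Finset F) (c : σ →₀ ℕ)
    (hc : Q.totalDegree + #T ≤ ∑ i, c i) :
    coeff c (Q * ∏ t ∈ T, (S - C t)) = coeff c (Q * S ^ #T) := by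
  induction T using Finset.induction_on generalizing Q with
  | empty => simp
  | insert t T ht ih =>
    rw [card_insert_of_notMem ht] at hc ⊢
    have hQS : (Q * S).totalDegree ≤ Q.totalDegree + 1 :=
      (totalDegree_mul _ _).trans (Nat.add_le_add_left hS _)
    have h0 : coeff c (Q * ∏ t ∈ T, (S - C t)) = 0 := by
      refine coeff_eq_zero_of_totalDegree_lt ?_
      have h1 := totalDegree_mul_prod_sub_C_le Q S hS T
      have h2 : ∑ i ∈ c.support, c i = ∑ i, c i := Finsupp.sum_fintype c (fun _ n => n) fun _ => rfl
      omega
    have hsplit : Q * ∏ t ∈ insert t T, (S - C t) =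
        Q * S * ∏ t ∈ T, (S - C t) - C t * (Q * ∏ t ∈ T, (S - C t)) := by
      rw [prod_insert ht]; ring
    rw [hsplit, coeff_sub, coeff_C_mul, h0, ih (Q * S) (by omega), pow_succ']
    ring_nf

open Finset MvPolynomial in
/-- If `Q * ∏ t ∈ T, (∑ i, X i - t)` has a single non-root on the grid `∏ C i` of the right size,
then the same polynomial with any other set `T'` of the same size has a non-root
on any grid with the same side lengths. -/
theorem exists_mem_piFinset_eval_ne_zero_of_unique {σ F : Type*} [Fintype σ] [DecidableEq σ]
    [Field F] [DecidableEq F] (Q : MvPolynomial σ F) (C C' : σ → Finset F)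
    (hC : ∀ i, (C i).Nonempty) (hCC' : ∀ i, #(C' i) = #(C i)) (T T' : Finset F) (hT : #T' = #T)
    (hdeg : Q.totalDegree + #T ≤ ∑ i, (#(C i) - 1)) (x₀ : σ → F) (hx₀ : ∀ i, x₀ i ∈ C i)
    (hQ₀ : eval x₀ Q ≠ 0) (hT₀ : ∑ i, x₀ i ∉ T)
    (huniq : ∀ x, (∀ i, x i ∈ C i) → eval x Q ≠ 0 → ∑ i, x i ∉ T → x = x₀) :
    ∃ x, (∀ i, x i ∈ C' i) ∧ eval x Q ≠ 0 ∧ ∑ i, x i ∉ T' := by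
  set S : MvPolynomial σ F := ∑ i, X i with hSdef
  have hS : S.totalDegree ≤ 1 :=
    (totalDegree_finsetSum _ _).trans (Finset.sup_le fun i _ => by simp)
  have heval : ∀ (T : Finset F) (x : σ → F),
      eval x (Q * ∏ t ∈ T, (S - MvPolynomial.C t)) ≠ 0 ↔ eval x Q ≠ 0 ∧ ∑ i, x i ∉ T := by
    intro T x
    simp only [map_mul, map_prod, map_sub, eval_C, mul_ne_zero_iff, prod_ne_zero_iff, hSdef,
      map_sum, eval_X, sub_ne_zero]
    exact and_congr_right fun _ => ⟨fun h hm => h _ hm rfl, fun h t ht he => h (he ▸ ht)⟩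
  by_contra! hno
  have h1 := sum_piFinset_eval_mul_prod_nodalWeight C hC (Q * ∏ t ∈ T, (S - MvPolynomial.C t))
    ((totalDegree_mul_prod_sub_C_le Q S hS T).trans hdeg)
  have h2 := sum_piFinset_eval_mul_prod_nodalWeight C'
    (fun i => by rw [← card_pos, hCC']; exact (hC i).card_pos)
    (Q * ∏ t ∈ T', (S - MvPolynomial.C t))
    ((totalDegree_mul_prod_sub_C_le Q S hS T').trans (by simpa only [hCC', hT] using hdeg))
  rw [coeff_mul_prod_sub_C Q S hS T _ hdeg] at h1
  rw [coeff_mul_prod_sub_C Q S hS T' _ (by simp only [hCC', hT]; exact hdeg)] at h2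
  simp only [hCC', hT] at h2
  rw [← h2, sum_eq_single x₀, sum_eq_zero] at h1
  · refine mul_ne_zero ((heval T x₀).2 ⟨hQ₀, hT₀⟩) (prod_ne_zero_iff.2 fun i _ => ?_) h1
    exact Lagrange.nodalWeight_ne_zero (v := id) Function.injective_id.injOn (hx₀ i)
  · intro x hx
    rw [Fintype.mem_piFinset] at hx
    have : ¬ eval x (Q * ∏ t ∈ T', (S - MvPolynomial.C t)) ≠ 0 := fun h =>
      ((heval T' x).1 h).2 (hno x hx ((heval T' x).1 h).1)
    rw [not_not.1 this, zero_mul]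
  · intro x hx hne
    rw [Fintype.mem_piFinset] at hx
    have : ¬ eval x (Q * ∏ t ∈ T, (S - MvPolynomial.C t)) ≠ 0 := fun h =>
      hne (huniq x hx ((heval T x).1 h).1 ((heval T x).1 h).2)
    rw [not_not.1 this, zero_mul]
  · intro h
    exact absurd (Fintype.mem_piFinset.2 hx₀) h

/-- The indices `j` such that `separator B` has a linear factor `X i ± X j` attached to `i`. -/
def separatorIndices {d : ℕ} (B : Finset (Fin d)) (i : Fin d) : Finset (Fin d) :=
  if i ∈ B then Finset.univ.erase i else Finset.univ.filter fun j => j ∈ B ∨ j < i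

open MvPolynomial in
/-- Up to sign, the product over pairs `i < j` of `X i - X j` if both indices lie outside `B`
and of `X i ^ 2 - X j ^ 2` otherwise. -/
noncomputable def separator {d : ℕ} (F : Type*) [Field F] (B : Finset (Fin d)) :
    MvPolynomial (Fin d) F :=
  ∏ i, ∏ j ∈ separatorIndices B i, if j < i then X i - X j else X i + X j

theorem notMem_separatorIndices_self {d : ℕ} (B : Finset (Fin d)) (i : Fin d) :
    i ∉ separatorIndices B i := by
  unfold separatorIndices
  split_ifs <;> simp [*]

open Finset MvPolynomial in
theorem totalDegree_separator_le {d : ℕ} (F : Type*) [Field F] (B : Finset (Fin d)) :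
    (separator F B).totalDegree ≤ ∑ i, #(separatorIndices B i) := by
  refine (totalDegree_finsetProd _ _).trans (sum_le_sum fun i _ => ?_)
  refine (totalDegree_finsetProd _ _).trans ?_
  refine (sum_le_card_nsmul _ _ 1 fun j _ => ?_).trans (by simp)
  split_ifs
  · exact (totalDegree_sub _ _).trans (by simp)
  · exact (totalDegree_add _ _).trans (by simp)

open Finset MvPolynomial in
theorem eval_separator_ne_zero_iff {d : ℕ} {F : Type*} [Field F] (B : Finset (Fin d))
    (y : Fin d → F) :
    eval y (separator F B) ≠ 0 ↔
      ∀ i j, i ≠ j → y i ≠ y j ∧ ((i ∈ B ∨ j ∈ B) → y i ≠ -y j) := by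
  have h1 : eval y (separator F B) ≠ 0 ↔
      ∀ i, ∀ j ∈ separatorIndices B i, (j < i → y i ≠ y j) ∧ (¬ j < i → y i ≠ -y j) := by
    simp only [separator, map_prod, prod_ne_zero_iff, mem_univ, true_imp_iff]
    refine forall_congr' fun i => forall_congr' fun j => imp_congr_right fun _ => ?_
    split_ifs with h <;> simp [h, sub_eq_zero, add_eq_zero_iff_eq_neg]
  rw [h1]
  have hmem : ∀ i j, j ∈ separatorIndices B i ↔ j ≠ i ∧ (i ∈ B ∨ j ∈ B ∨ j < i) := by
    intro i j
    unfold separatorIndices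
    split_ifs with h
    · simp [h]
    · simp only [mem_filter, mem_univ, true_and, h, false_or]
      refine ⟨fun h' => ⟨?_, h'⟩, fun h' => h'.2⟩
      rintro rfl
      exact h'.elim h (lt_irrefl _)
  simp only [hmem]
  constructor
  · intro h i j hij
    rcases lt_or_gt_of_ne hij with hlt | hlt
    · refine ⟨((h j i ⟨hij, Or.inr (Or.inr hlt)⟩).1 hlt).symm, fun hB => ?_⟩
      exact (h i j ⟨hij.symm, hB.elim Or.inl fun h => Or.inr (Or.inl h)⟩).2 hlt.not_gt
    · refine ⟨(h i j ⟨hij.symm, Or.inr (Or.inr hlt)⟩).1 hlt, fun hB he => ?_⟩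
      refine (h j i ⟨hij, hB.elim (fun h => Or.inr (Or.inl h)) Or.inl⟩).2 hlt.not_gt ?_
      rw [he, neg_neg]
  · rintro h i j ⟨hne, hB⟩
    refine ⟨fun _ => (h i j hne.symm).1, fun hji => (h i j hne.symm).2 ?_⟩
    tauto

open Finset in
/-- A signed enumeration of `A` has sum `2 s - ∑ a ∈ A, a`, where `s` is the sum of the elements
occurring with positive sign. -/
theorem sum_signed_enumeration {d : ℕ} {G : Type*} [CommRing G] [DecidableEq G] (A : Finset G)
    (hd : #A = d) (y : Fin d → G) (hy : ∀ i, y i ∈ A ∨ -y i ∈ A)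
    (hinj : ∀ i j, i ≠ j → y i ≠ y j ∧ y i ≠ -y j) :
    ∑ i, y i = 2 * ∑ a ∈ (univ.filter fun i => y i ∈ A).image y, a - ∑ a ∈ A, a := by
  set φ : Fin d → G := fun i => if y i ∈ A then y i else -y i with hφ
  have hφA : ∀ i, φ i ∈ A := by
    intro i
    simp only [hφ]
    split_ifs with h
    · exact h
    · exact (hy i).resolve_left h
  have hφinj : Function.Injective φ := by
    intro i j h
    by_contra hij
    obtain ⟨h1, h2⟩ := hinj i j hij
    simp only [hφ] at h
    split_ifs at h
    · exact h1 h
    · exact h2 h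
    · exact h2 (by rw [← h, neg_neg])
    · exact h1 (neg_injective h)
  have himg : univ.image φ = A := by
    refine eq_of_subset_of_card_le (image_subset_iff.2 fun i _ => hφA i) ?_
    rw [card_image_of_injective _ hφinj, hd, card_univ, Fintype.card_fin]
  have hsumA : ∑ a ∈ A, a = ∑ i, φ i := by
    rw [← himg, sum_image hφinj.injOn]
  have hyinj : Set.InjOn y (univ.filter fun i => y i ∈ A) := fun i _ j _ h => by
    by_contra hij
    exact (hinj i j hij).1 h
  rw [hsumA, sum_image hyinj, sum_filter, mul_sum, ← sum_sub_distrib]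
  refine sum_congr rfl fun i _ => ?_
  simp only [hφ]
  split_ifs <;> ring

open Finset in
/-- Among the signed enumerations `z` of `1, …, d` whose negative entries are bounded below by
`-b` at the places `b ∈ B`, and which are positive elsewhere with `z e ∈ B ∪ {e' ∉ B | e' ≤ e}`,
only one reaches the minimal sum. Indices are shifted by one. -/
theorem eq_of_sum_negPart_ge {d : ℕ} (B : Finset (Fin d)) (z : Fin d → ℤ)
    (hB : ∀ i ∈ B, -((i : ℤ) + 1) ≤ z i)
    (hE : ∀ i ∉ B, ∃ j, (j ∈ B ∨ j ≤ i) ∧ z i = (j : ℤ) + 1)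
    (hinj : ∀ i j, i ≠ j → z i ≠ z j ∧ ((i ∈ B ∨ j ∈ B) → z i ≠ -z j))
    (hsum : ∑ i ∈ B, ((i : ℤ) + 1) ≤ ∑ i, (z i)⁻) :
    ∀ i, z i = if i ∈ B then -((i : ℤ) + 1) else (i : ℤ) + 1 := by
  have hEneg : ∀ i ∉ B, (z i)⁻ = 0 := by
    intro i hi
    obtain ⟨j, -, hj⟩ := hE i hi
    rw [negPart_eq_zero]
    omega
  have hle : ∀ i ∈ B, (z i)⁻ ≤ (i : ℤ) + 1 := by
    intro i hi
    have := hB i hi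
    rw [negPart_def]
    exact sup_le (by omega) (by omega)
  have hsum' : ∑ i, (z i)⁻ = ∑ i ∈ B, (z i)⁻ :=
    (sum_subset (subset_univ B) fun i _ hi => hEneg i hi).symm
  have heq := (sum_eq_sum_iff_of_le hle).1 (le_antisymm (sum_le_sum hle) (hsum' ▸ hsum))
  have hBz : ∀ i ∈ B, z i = -((i : ℤ) + 1) := by
    intro i hi
    have h := heq i hi
    rcases le_total 0 (z i) with h0 | h0
    · rw [negPart_eq_zero.2 h0] at h
      omega
    · rw [negPart_of_nonpos h0] at h
      omega
  have hEz : ∀ n (i : Fin d), (i : ℕ) = n → i ∉ B → z i = (i : ℤ) + 1 := by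
    intro n
    induction n using Nat.strong_induction_on with
    | _ n ih =>
      intro i hin hi
      obtain ⟨j, hj, hz⟩ := hE i hi
      by_cases hji : j = i
      · rw [hz, hji]
      by_cases hjB : j ∈ B
      · exfalso
        refine (hinj i j (Ne.symm hji)).2 (Or.inr hjB) ?_
        rw [hz, hBz j hjB, neg_neg]
      · have hlt : j < i := lt_of_le_of_ne (hj.resolve_left hjB) hji
        exact absurd (hz.trans (ih j (by rw [← hin]; exact hlt) j rfl hjB).symm)
          (hinj i j (Ne.symm hji)).1
  intro i
  split_ifs with h
  · exact hBz i h
  · exact hEz i i rfl h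

open Finset in
theorem sum_eq_sub_two_mul_sum_negPart {d : ℕ} (z : Fin d → ℤ) (h0 : ∀ i, z i ≠ 0)
    (hd : ∀ i, |z i| ≤ d) (hinj : ∀ i j, i ≠ j → z i ≠ z j ∧ z i ≠ -z j) :
    ∑ i, z i = ∑ n ∈ Icc (1 : ℤ) d, n - 2 * ∑ i, (z i)⁻ := by
  have hφinj : Function.Injective fun i => |z i| := by
    intro i j h
    by_contra hij
    rcases abs_eq_abs.1 h with h | h
    · exact (hinj i j hij).1 h
    · exact (hinj i j hij).2 h
  have himg : univ.image (fun i => |z i|) = Icc (1 : ℤ) d := by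
    refine eq_of_subset_of_card_le (image_subset_iff.2 fun i _ => ?_) ?_
    · rw [mem_Icc]
      exact ⟨Int.one_le_abs (h0 i), hd i⟩
    · rw [card_image_of_injective _ hφinj]
      simp
  rw [← himg, sum_image hφinj.injOn, mul_sum, ← sum_sub_distrib]
  refine sum_congr rfl fun i _ => ?_
  have h1 := posPart_add_negPart (z i)
  have h2 := posPart_sub_negPart (z i)
  omega

theorem ZMod.intCast_ne_zero_of_abs_lt {p : ℕ} {a : ℤ} (h0 : a ≠ 0) (ha : |a| < p) :
    (a : ZMod p) ≠ 0 := fun h =>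
  h0 (Int.eq_zero_of_abs_lt_dvd ((ZMod.intCast_zmod_eq_zero_iff_dvd a p).1 h) ha)

open Finset in
theorem card_union_image_neg {G : Type*} [AddCommGroup G] [DecidableEq G] (A : Finset G)
    (hA : ∀ a ∈ A, -a ∉ A) : #(A ∪ A.image Neg.neg) = 2 * #A := by
  rw [card_union_of_disjoint, card_image_of_injective _ neg_injective, two_mul]
  rw [disjoint_left]
  intro a ha h
  obtain ⟨b, hb, rfl⟩ := mem_image.1 h
  exact hA b hb ha

open Finset in
theorem two_mul_card_lt_of_forall_neg_notMem {p : ℕ} [NeZero p] (A : Finset (ZMod p))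
    (hA : ∀ a ∈ A, -a ∉ A) : 2 * #A < p := by
  rw [← card_union_image_neg A hA]
  have h0 : (0 : ZMod p) ∉ A ∪ A.image Neg.neg := by
    have h : (0 : ZMod p) ∉ A := fun h => hA 0 h (by rwa [neg_zero])
    simp [h]
  have := card_lt_univ_of_notMem h0
  rwa [ZMod.card] at this

/-- The integer grid on which `eq_of_sum_negPart_ge` singles out one point. -/
noncomputable def modelGrid {d : ℕ} (B : Finset (Fin d)) (i : Fin d) : Finset ℤ :=
  if i ∈ B then (Finset.Icc (-((i : ℤ) + 1)) d).erase 0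
  else (insert i (separatorIndices B i)).image fun j : Fin d => (j : ℤ) + 1

open Finset in
theorem card_modelGrid {d : ℕ} (B : Finset (Fin d)) (i : Fin d) :
    #(modelGrid B i) = #(separatorIndices B i) + 1 + if i ∈ B then (i : ℕ) + 1 else 0 := by
  unfold modelGrid
  have := i.2
  split_ifs with h
  · rw [card_erase_of_mem (by rw [mem_Icc]; omega), Int.card_Icc, separatorIndices, if_pos h,
      card_erase_of_mem (mem_univ i), card_univ, Fintype.card_fin]
    omega
  · rw [card_image_of_injective _ fun a b hab => Fin.ext (by simpa using hab),
      card_insert_of_notMem (notMem_separatorIndices_self B i), add_zero]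

open Finset in
theorem card_modelGrid_le {d : ℕ} (B : Finset (Fin d)) (i : Fin d) :
    #(modelGrid B i) ≤ if i ∈ B then 2 * d else d := by
  rw [card_modelGrid, ← card_insert_of_notMem (notMem_separatorIndices_self B i)]
  have := card_le_univ (insert i (separatorIndices B i))
  rw [Fintype.card_fin] at this
  have := i.2
  split_ifs <;> omega

open Finset in
theorem mem_modelGrid_of_mem {d : ℕ} {B : Finset (Fin d)} {i : Fin d} (hi : i ∈ B) {z : ℤ} :
    z ∈ modelGrid B i ↔ z ≠ 0 ∧ -((i : ℤ) + 1) ≤ z ∧ z ≤ d := by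
  rw [modelGrid, if_pos hi, mem_erase, mem_Icc]

open Finset in
theorem mem_modelGrid_of_notMem {d : ℕ} {B : Finset (Fin d)} {i : Fin d} (hi : i ∉ B) {z : ℤ} :
    z ∈ modelGrid B i ↔ ∃ j, (j ∈ B ∨ j ≤ i) ∧ z = (j : ℤ) + 1 := by
  rw [modelGrid, if_neg hi, mem_image]
  unfold separatorIndices
  rw [if_neg hi]
  refine exists_congr fun j => and_congr ?_ eq_comm
  simp only [mem_insert, mem_filter, mem_univ, true_and, le_iff_eq_or_lt]
  tauto

open Finset in
theorem bounds_of_mem_modelGrid {d : ℕ} {B : Finset (Fin d)} {i : Fin d} {z : ℤ}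
    (hz : z ∈ modelGrid B i) : z ≠ 0 ∧ |z| ≤ d ∧ (i ∉ B → 0 < z) := by
  have := i.2
  by_cases hi : i ∈ B
  · rw [mem_modelGrid_of_mem hi] at hz
    exact ⟨hz.1, abs_le.2 (by omega), fun h => absurd hi h⟩
  · obtain ⟨j, -, rfl⟩ := (mem_modelGrid_of_notMem hi).1 hz
    have := j.2
    exact ⟨by omega, abs_le.2 (by omega), fun _ => by omega⟩

open Finset MvPolynomial in
theorem sum_lt_card_sigmaGe (p : ℕ) [Fact p.Prime] (A : Finset (ZMod p))
    (hA : ∀ a ∈ A, -a ∉ A) {d : ℕ} (hd : #A = d) (B : Finset (Fin d))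
    (hM : ∑ i ∈ B, ((i : ℕ) + 1) < p) :
    ∑ i ∈ B, ((i : ℕ) + 1) < #(SigmaGe A (d - #B)) := by
  by_contra! hle
  have hdp : 2 * d < p := hd ▸ two_mul_card_lt_of_forall_neg_notMem A hA
  set M := ∑ i ∈ B, ((i : ℕ) + 1) with hMdef
  set D : ℤ := ∑ n ∈ Icc (1 : ℤ) d, n with hD
  have hcast : ∀ {a b : ℤ}, |a - b| < p → (a : ZMod p) = b → a = b := by
    intro a b hab h
    by_contra hne
    exact ZMod.intCast_ne_zero_of_abs_lt (sub_ne_zero.2 hne) hab (by push_cast; rw [h, sub_self])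
  have htwo : ∀ {m n : ℕ}, m ≤ M → n ≤ M →
      ((D - 2 * m : ℤ) : ZMod p) = ((D - 2 * n : ℤ) : ZMod p) → m = n := by
    intro m n hm hn h
    by_cases hd0 : d = 0
    · have : M = 0 := by
        subst hd0
        simp [hMdef]
      omega
    have h2 : ((2 : ℤ) : ZMod p) ≠ 0 := ZMod.intCast_ne_zero_of_abs_lt (by norm_num) (by
      rw [abs_of_pos (by norm_num)]
      omega)
    have h3 : ((m : ℤ) : ZMod p) = ((n : ℤ) : ZMod p) := by
      push_cast at h h2 ⊢
      exact mul_left_cancel₀ h2 (sub_right_injective h)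
    exact_mod_cast hcast (abs_lt.2 (by omega)) h3
  obtain ⟨T', hT'sub, hT'card⟩ : ∃ T' : Finset (ZMod p),
      (SigmaGe A (d - #B)).image (fun x => 2 * x - ∑ a ∈ A, a) ⊆ T' ∧ #T' = M :=
    exists_superset_card_eq (card_image_le.trans hle) (by rw [ZMod.card]; exact hM.le)
  set T : Finset (ZMod p) := (range M).image fun n : ℕ => ((D - 2 * n : ℤ) : ZMod p) with hT
  have hTcard : #T = M := by
    rw [hT, card_image_of_injOn, card_range]
    intro m hm n hn h
    have hm' := mem_range.1 (mem_coe.1 hm)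
    have hn' := mem_range.1 (mem_coe.1 hn)
    exact htwo hm'.le hn'.le h
  set C : Fin d → Finset (ZMod p) := fun i => (modelGrid B i).image fun z : ℤ => (z : ZMod p)
    with hC
  have hCcard : ∀ i, #(C i) = #(modelGrid B i) := by
    intro i
    refine card_image_of_injOn fun a ha b hb h => hcast ?_ h
    have ha' := abs_le.1 (bounds_of_mem_modelGrid (mem_coe.1 ha)).2.1
    have hb' := abs_le.1 (bounds_of_mem_modelGrid (mem_coe.1 hb)).2.1
    rw [abs_lt]
    omega
  have hC' : ∀ i, ∃ C' ⊆ if i ∈ B then A ∪ A.image Neg.neg else A, #C' = #(C i) := by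
    intro i
    refine exists_subset_card_eq ?_
    rw [hCcard]
    refine (card_modelGrid_le B i).trans ?_
    split_ifs
    · rw [card_union_image_neg A hA, hd]
    · exact hd.ge
  choose C' hC'sub hC'card using hC'
  set z₀ : Fin d → ℤ := fun i => if i ∈ B then -((i : ℤ) + 1) else (i : ℤ) + 1 with hz₀
  have hz₀mem : ∀ i, z₀ i ∈ modelGrid B i := by
    intro i
    have := i.2
    simp only [hz₀]
    split_ifs with hi
    · rw [mem_modelGrid_of_mem hi]
      omega
    · rw [mem_modelGrid_of_notMem hi]
      exact ⟨i, Or.inr le_rfl, rfl⟩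
  have hz₀abs : ∀ i, |z₀ i| = (i : ℤ) + 1 := by
    intro i
    simp only [hz₀]
    split_ifs
    · rw [abs_neg, abs_of_nonneg (by positivity)]
    · rw [abs_of_nonneg (by positivity)]
  have hz₀inj : ∀ i j, i ≠ j → z₀ i ≠ z₀ j ∧ z₀ i ≠ -z₀ j := by
    intro i j hij
    have hne : |z₀ i| ≠ |z₀ j| := by
      rw [hz₀abs, hz₀abs]
      intro h
      exact hij (Fin.ext (by omega))
    exact ⟨fun h => hne (by rw [h]), fun h => hne (by rw [h, abs_neg])⟩
  have hz₀neg : ∑ i, (z₀ i)⁻ = M := by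
    rw [← sum_subset (subset_univ B), hMdef, Nat.cast_sum]
    · refine sum_congr rfl fun i hi => ?_
      simp only [hz₀, if_pos hi]
      rw [negPart_of_nonpos (by omega)]
      push_cast
      ring
    · intro i _ hi
      simp only [hz₀, if_neg hi]
      rw [negPart_eq_zero]
      positivity
  obtain ⟨x, hxC', hxQ, hxT'⟩ : ∃ x : Fin d → ZMod p, (∀ i, x i ∈ C' i) ∧
      eval x (separator (ZMod p) B) ≠ 0 ∧ ∑ i, x i ∉ T' := by
    refine exists_mem_piFinset_eval_ne_zero_of_unique
      (separator (ZMod p) B) C C' (fun i => ⟨_, mem_image_of_mem _ (hz₀mem i)⟩) hC'card T T'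
      (hT'card.trans hTcard.symm) ?_ (fun i => (z₀ i : ZMod p))
      (fun i => mem_image_of_mem _ (hz₀mem i)) ?_ ?_ ?_
    · rw [hTcard]
      refine (Nat.add_le_add_right (totalDegree_separator_le (ZMod p) B) M).trans_eq ?_
      have : M = ∑ i, if i ∈ B then (i : ℕ) + 1 else 0 := by
        rw [← sum_filter, filter_univ_mem]
      rw [this, ← sum_add_distrib]
      refine sum_congr rfl fun i _ => ?_
      rw [hCcard, card_modelGrid]
      omega
    · rw [eval_separator_ne_zero_iff]
      intro i j hij
      have hi := abs_le.1 (bounds_of_mem_modelGrid (hz₀mem i)).2.1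
      have hj := abs_le.1 (bounds_of_mem_modelGrid (hz₀mem j)).2.1
      refine ⟨fun h => (hz₀inj i j hij).1 (hcast (abs_lt.2 (by omega)) h), fun _ h => ?_⟩
      refine (hz₀inj i j hij).2 (hcast (abs_lt.2 (by omega)) ?_)
      rw [h]
      push_cast
      rfl
    · intro h
      obtain ⟨n, hn, h⟩ := mem_image.1 h
      rw [mem_range] at hn
      rw [← Int.cast_sum, sum_eq_sub_two_mul_sum_negPart z₀
        (fun i => (bounds_of_mem_modelGrid (hz₀mem i)).1)
        (fun i => (bounds_of_mem_modelGrid (hz₀mem i)).2.1) hz₀inj, hz₀neg, ← hD] at h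
      exact hn.ne (htwo hn.le le_rfl h)
    · intro x hxC hxQ hxT
      have hz : ∀ i, ∃ z ∈ modelGrid B i, (z : ZMod p) = x i := fun i => mem_image.1 (hxC i)
      choose z hzmem hzx using hz
      rw [eval_separator_ne_zero_iff] at hxQ
      have hzinj : ∀ i j, i ≠ j → z i ≠ z j ∧ z i ≠ -z j := by
        intro i j hij
        refine ⟨fun h => (hxQ i j hij).1 (by rw [← hzx, ← hzx, h]), fun h => ?_⟩
        by_cases hB : i ∈ B ∨ j ∈ B
        · exact (hxQ i j hij).2 hB (by rw [← hzx, ← hzx, h]; push_cast; rfl)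
        · rw [not_or] at hB
          have h1 := (bounds_of_mem_modelGrid (hzmem i)).2.2 hB.1
          have h2 := (bounds_of_mem_modelGrid (hzmem j)).2.2 hB.2
          omega
      have hsum := sum_eq_sub_two_mul_sum_negPart z
        (fun i => (bounds_of_mem_modelGrid (hzmem i)).1)
        (fun i => (bounds_of_mem_modelGrid (hzmem i)).2.1) hzinj
      obtain ⟨N, hN⟩ := Int.eq_ofNat_of_zero_le
        (sum_nonneg fun i _ => negPart_nonneg (z i) : 0 ≤ ∑ i, (z i)⁻)
      have hNM : M ≤ N := by
        by_contra! hlt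
        refine hxT (mem_image.2 ⟨N, mem_range.2 hlt, ?_⟩)
        rw [hD, ← hN, ← hsum, Int.cast_sum]
        exact sum_congr rfl fun i _ => hzx i
      have hzz : ∀ i, z i = z₀ i := by
        refine eq_of_sum_negPart_ge B z (fun i hi => ((mem_modelGrid_of_mem hi).1 (hzmem i)).2.1)
          (fun i hi => (mem_modelGrid_of_notMem hi).1 (hzmem i))
          (fun i j hij => ⟨(hzinj i j hij).1, fun _ => (hzinj i j hij).2⟩) ?_
        rw [hN]
        have : ((M : ℕ) : ℤ) ≤ N := by exact_mod_cast hNM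
        refine le_trans (le_of_eq ?_) this
        rw [hMdef]
        push_cast
        rfl
      funext i
      rw [← hzx, hzz]
  rw [eval_separator_ne_zero_iff] at hxQ
  have hxE : ∀ i ∉ B, x i ∈ A := fun i hi => by simpa [hi] using hC'sub i (hxC' i)
  have hxA : ∀ i, x i ∈ A ∨ -x i ∈ A := by
    intro i
    by_cases hi : i ∈ B
    · have h := hC'sub i (hxC' i)
      rw [if_pos hi, mem_union, mem_image] at h
      refine h.imp_right ?_
      rintro ⟨a, ha, h⟩
      rwa [← h, neg_neg]
    · exact Or.inl (hxE i hi)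
  have hxinj : ∀ i j, i ≠ j → x i ≠ x j ∧ x i ≠ -x j := by
    intro i j hij
    refine ⟨(hxQ i j hij).1, fun h => ?_⟩
    by_cases hB : i ∈ B ∨ j ∈ B
    · exact (hxQ i j hij).2 hB h
    · rw [not_or] at hB
      exact hA _ (hxE j hB.2) (h ▸ hxE i hB.1)
  refine hxT' (hT'sub (mem_image.2 ⟨_, ?_, (sum_signed_enumeration A hd x hxA hxinj).symm⟩))
  refine mem_image.2 ⟨(univ.filter fun i => x i ∈ A).image x, ?_, rfl⟩
  rw [mem_filter, mem_powerset]
  refine ⟨fun a ha => ?_, ?_⟩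
  · obtain ⟨i, hi, rfl⟩ := mem_image.1 ha
    exact (mem_filter.1 hi).2
  · rw [card_image_of_injOn fun i _ j _ h => by
      by_contra hij
      exact (hxinj i j hij).1 h]
    have : #Bᶜ = d - #B := by rw [card_compl, Fintype.card_fin]
    rw [← this]
    refine card_le_card fun i hi => ?_
    exact mem_filter.2 ⟨mem_univ i, hxE i (mem_compl.1 hi)⟩

open Finset in
theorem SigmaGe_mono {M : Type*} [AddCommMonoid M] [DecidableEq M] {A A' : Finset M} {α α' : ℕ}
    (hA : A' ⊆ A) (hα : α ≤ α') : SigmaGe A' α' ⊆ SigmaGe A α := by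
  refine image_subset_image fun S hS => ?_
  rw [mem_filter, mem_powerset] at hS ⊢
  exact ⟨hS.1.trans hA, hα.trans hS.2⟩

open Finset in
theorem sum_Ico_succ_eq {α n : ℕ} (h : α ≤ n) :
    ∑ i ∈ Ico α n, (i + 1) = n * (n + 1) / 2 - α * (α + 1) / 2 := by
  have hgauss : ∀ n, ∑ i ∈ range n, (i + 1) = n * (n + 1) / 2 := by
    intro n
    have := sum_range_succ' (fun i => i) n
    rw [add_zero] at this
    rw [← this, sum_range_id, Nat.add_sub_cancel, mul_comm]
  rw [← hgauss, ← hgauss, ← sum_range_add_sum_Ico _ h, Nat.add_sub_cancel_left]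

open Finset in
theorem exists_subset_range_sum_eq {α n : ℕ} (hα : 1 ≤ α) (hαn : α ≤ n) (s : ℕ)
    (hs : s ≤ ∑ i ∈ Ico α n, (i + 1)) :
    ∃ d ≤ n, ∃ B ⊆ range d, #B + α = d ∧ ∑ i ∈ B, (i + 1) = s := by
  induction s with
  | zero => exact ⟨α, hαn, ∅, empty_subset _, by simp, by simp⟩
  | succ s ih =>
    obtain ⟨d, hdn, B, hBd, hcard, hsum⟩ := ih (by omega)
    by_cases hstep : ∃ b ∈ B, b + 1 < d ∧ b + 1 ∉ B
    · obtain ⟨b, hb, hbd, hb'⟩ := hstep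
      have hnot : b + 1 ∉ B.erase b := fun h => hb' (mem_of_mem_erase h)
      refine ⟨d, hdn, insert (b + 1) (B.erase b), ?_, ?_, ?_⟩
      · exact insert_subset (mem_range.2 hbd) ((erase_subset _ _).trans hBd)
      · rw [card_insert_of_notMem hnot, card_erase_add_one hb, hcard]
      · rw [sum_insert hnot]
        have := add_sum_erase B (fun i => i + 1) hb
        omega
    · push Not at hstep
      have hB : B = Ico α d := by
        rcases B.eq_empty_or_nonempty with rfl | hne
        · rw [card_empty, zero_add] at hcard
          rw [hcard, Ico_self]
        · have hIco : B = Ico (B.min' hne) d := by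
            refine Subset.antisymm (fun b hb => ?_) (fun b hb => ?_)
            · exact mem_Ico.2 ⟨B.min'_le b hb, mem_range.1 (hBd hb)⟩
            · rw [mem_Ico] at hb
              obtain ⟨h1, h2⟩ := hb
              induction b, h1 using Nat.le_induction with
              | base => exact B.min'_mem hne
              | succ b _ ihb => exact hstep b (ihb (by omega)) h2
          have hlt := mem_range.1 (hBd (B.min'_mem hne))
          have hc := congrArg card hIco
          rw [Nat.card_Ico] at hc
          rw [hIco]
          congr 1
          omega
      have hlt : d < n := by
        refine lt_of_le_of_ne hdn ?_
        rintro rfl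
        rw [hB] at hsum
        omega
      have h0 : 0 ∉ B := by
        rw [hB, mem_Ico]
        omega
      refine ⟨d + 1, hlt, insert 0 B, ?_, ?_, ?_⟩
      · exact insert_subset (by simp) (hBd.trans (range_subset_range.2 (Nat.le_succ d)))
      · rw [card_insert_of_notMem h0]
        omega
      · rw [sum_insert h0, hsum]
        omega

open Finset in
theorem sum_lt_card_sigmaGe_of_subset_range (p : ℕ) [Fact p.Prime] (A : Finset (ZMod p))
    (hA : ∀ a ∈ A, -a ∉ A) {α d : ℕ} (hd : d ≤ #A) (B : Finset ℕ) (hB : B ⊆ range d)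
    (hcard : #B + α = d) (hM : ∑ i ∈ B, (i + 1) < p) :
    ∑ i ∈ B, (i + 1) < #(SigmaGe A α) := by
  obtain ⟨A', hA'A, hA'⟩ := exists_subset_card_eq hd
  have hmem : ∀ i ∈ B, i < d := fun i hi => mem_range.1 (hB hi)
  have hsum : ∑ i ∈ B.attachFin hmem, ((i : ℕ) + 1) = ∑ i ∈ B, (i + 1) := by
    conv_rhs => rw [← map_valEmbedding_attachFin hmem, sum_map]
    rfl
  have h := sum_lt_card_sigmaGe p A' (fun a ha h => hA a (hA'A ha) (hA'A h)) hA'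
    (B.attachFin hmem) (by rwa [hsum])
  rw [hsum, card_attachFin] at h
  exact h.trans_le (card_le_card (SigmaGe_mono hA'A (by omega)))

theorem sigma_ge_card_bound (p : ℕ) (hp : p.Prime) (A : Finset (ZMod p))
    (hA : ∀ a ∈ A, -a ∉ A) (α : ℕ) (hα : α ≤ A.card) :
    min p (A.card * (A.card + 1) / 2 - α * (α + 1) / 2 + 1) ≤ (SigmaGe A α).card := by
  have : Fact p.Prime := ⟨hp⟩
  rw [← sum_Ico_succ_eq hα]
  rcases lt_or_ge (∑ i ∈ Finset.Ico α A.card, (i + 1)) p with hlt | hge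
  · refine (min_le_right _ _).trans ?_
    refine sum_lt_card_sigmaGe_of_subset_range p A hA le_rfl (Finset.Ico α A.card) ?_ ?_ hlt
    · exact fun i hi => Finset.mem_range.2 (Finset.mem_Ico.1 hi).2
    · rw [Nat.card_Ico]
      omega
  · refine (min_le_left _ _).trans ?_
    have hp0 := hp.pos
    have hαA : α < A.card := by
      by_contra! h
      rw [Finset.Ico_eq_empty_of_le h, Finset.sum_empty] at hge
      omega
    obtain ⟨d, hd, B, hB, hcard, hsum⟩ := exists_subset_range_sum_eq (le_max_right α 1)
      (max_le hα (by omega) : max α 1 ≤ A.card) (p - 1) (by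
        rcases Nat.eq_zero_or_pos α with rfl | h
        · rw [Finset.sum_eq_sum_Ico_succ_bot hαA] at hge
          simp only [zero_add] at hge
          rw [max_eq_right zero_le_one]
          omega
        · rw [max_eq_left h]
          omega)
    have h := sum_lt_card_sigmaGe_of_subset_range p A hA hd B hB hcard (by omega)
    have := Finset.card_le_card (SigmaGe_mono (Finset.Subset.refl A) (le_max_left α 1))
    omega
end

section
/- Let p be a prime and A ⊆ F_p with A ∩ (-A) = ∅ and |A|(|A|+1)/2 ≥ p. Then Σ(A) = F_p, i.e., every element of F_p is a subset sum of A. -/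
open Finset

/-- The reciprocal factorial `1 / (m - e)!`, with value `0` when `m < e`. -/
noncomputable def invFactorialSub (K : Type*) [Field K] (m e : ℕ) : K :=
  if e ≤ m then ((m - e).factorial : K)⁻¹ else 0

theorem sum_units_int_mul_pow {K : Type*} [Field K] (x : K) (m : ℕ) :
    ∑ u : ℤˣ, ((u : ℤ) : K) * (((u : ℤ) : K) * x) ^ m = (if Odd m then 2 else 0) * x ^ m := by
  rw [UnitsInt.univ, sum_pair (by decide)]
  split_ifs with h
  · simp [h.neg_pow]; ring
  · simp [(Nat.not_odd_iff_even.mp h).neg_pow]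

theorem pow_sum_eq_sum_piAntidiag_inv_factorial {K : Type*} [Field K] {d k : ℕ}
    (hk : (k.factorial : K) ≠ 0) (y : Fin d → K) :
    (∑ i, y i) ^ k =
      k.factorial * ∑ n ∈ piAntidiag univ k, ∏ i, ((n i).factorial : K)⁻¹ * y i ^ n i := by
  rw [sum_pow_eq_sum_piAntidiag, mul_sum]
  refine sum_congr rfl fun n hn => ?_
  have hs : univ.sum n = k := (mem_piAntidiag.mp hn).1
  have h := Nat.multinomial_spec univ n
  rw [hs] at h
  have h' : (∏ i, ((n i).factorial : K)) * (Nat.multinomial univ n : K) = k.factorial := by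
    rw [← h]; push_cast; rfl
  have h0 : (∏ i, ((n i).factorial : K)) ≠ 0 := by
    intro h0; rw [h0, zero_mul] at h'; exact hk h'.symm
  rw [prod_mul_distrib, prod_inv_distrib, ← h']
  field_simp

theorem sum_piAntidiag_shift {K : Type*} [Field K] {d : ℕ} (k : ℕ) (e : Fin d → ℕ)
    (g : Fin d → ℕ → K) :
    ∑ n ∈ piAntidiag univ k, ∏ i, ((n i).factorial : K)⁻¹ * g i (n i + e i) =
      ∑ m ∈ piAntidiag univ (k + ∑ i, e i), ∏ i, invFactorialSub K (m i) (e i) * g i (m i) := by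
  refine sum_of_injOn (fun n => n + e) (fun _ _ _ _ h => add_right_cancel h) ?_ ?_ ?_
  · intro n hn
    simp only [mem_coe, mem_piAntidiag] at hn ⊢
    simp [sum_add_distrib, hn.1]
  · intro m hm hm'
    obtain ⟨i, hi⟩ : ∃ i, m i < e i := by
      by_contra! hle
      refine hm' ⟨m - e, ?_, funext fun i => Nat.sub_add_cancel (hle i)⟩
      simp only [mem_coe, mem_piAntidiag] at hm ⊢
      refine ⟨?_, by simp⟩
      have h : ∑ i, (m i - e i) + ∑ i, e i = ∑ i, m i := by
        rw [← sum_add_distrib]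
        exact sum_congr rfl fun i _ => Nat.sub_add_cancel (hle i)
      have h2 : ∑ i, m i = _ := hm.1
      simp only [Pi.sub_apply]
      omega
    exact prod_eq_zero (mem_univ i) (by simp [invFactorialSub, hi])
  · intro n _
    simp [invFactorialSub]

theorem sum_signs_mul_pow_mul_det {K : Type*} [Field K] {d k : ℕ}
    (hk : (k.factorial : K) ≠ 0) (a : Fin d → K) (e : Fin d → ℕ) :
    ∑ ε : Fin d → ℤˣ, (∏ i, ((ε i : ℤ) : K)) * (∑ i, ((ε i : ℤ) : K) * a i) ^ k *
        (Matrix.of fun j i => (((ε i : ℤ) : K) * a i) ^ e j).det =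
      k.factorial * ∑ m ∈ piAntidiag univ (k + ∑ i, e i),
        (∏ i, (if Odd (m i) then 2 else 0) * a i ^ m i) *
          (Matrix.of fun j i => invFactorialSub K (m i) (e j)).det := by
  have key : ∀ σ : Equiv.Perm (Fin d),
      ∑ ε : Fin d → ℤˣ, (∏ i, ((ε i : ℤ) : K)) * (∑ i, ((ε i : ℤ) : K) * a i) ^ k *
        ∏ i, (((ε i : ℤ) : K) * a i) ^ e (σ i) =
      k.factorial * ∑ m ∈ piAntidiag univ (k + ∑ i, e i),
        (∏ i, (if Odd (m i) then 2 else 0) * a i ^ m i) *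
          ∏ i, invFactorialSub K (m i) (e (σ i)) := by
    intro σ
    have h := sum_piAntidiag_shift (K := K) k (e ∘ σ)
      (fun i m => (if Odd m then 2 else 0) * a i ^ m)
    simp only [Function.comp_apply, Equiv.sum_comp σ e] at h
    simp only [← prod_mul_distrib]
    simp only [mul_comm _ (invFactorialSub K _ _)]
    rw [← h]
    simp only [pow_sum_eq_sum_piAntidiag_inv_factorial hk, mul_sum, sum_mul]
    rw [sum_comm]
    refine sum_congr rfl fun n _ => ?_
    simp only [← sum_units_int_mul_pow, mul_sum (univ : Finset ℤˣ), Fintype.prod_sum]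
    rw [mul_sum]
    refine sum_congr rfl fun ε _ => ?_
    simp only [prod_mul_distrib, pow_add]
    ring
  simp only [Matrix.det_apply', Matrix.of_apply, mul_sum]
  rw [sum_comm, sum_comm (s := piAntidiag _ _)]
  refine sum_congr rfl fun σ _ => ?_
  have h := congrArg (fun z => ((Equiv.Perm.sign σ : ℤ) : K) * z) (key σ)
  simp only [mul_sum] at h
  convert h using 2 <;> ring_nf

theorem eq_range_of_sum_le {s : Finset ℕ} (h : ∑ x ∈ s, x ≤ ∑ x ∈ range #s, x) :
    s = range #s := by
  set r := range #s with hr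
  have hc : #(s \ r) = #(r \ s) := card_sdiff_comm (by simp [hr])
  have h1 : #(s \ r) * #s ≤ ∑ x ∈ s \ r, x := by
    rw [← smul_eq_mul]
    exact card_nsmul_le_sum _ _ _ fun x hx => by simpa [hr] using (mem_sdiff.mp hx).2
  have h2 : ∑ x ∈ r \ s, (x + 1) ≤ #(r \ s) * #s := by
    rw [← smul_eq_mul]
    exact sum_le_card_nsmul _ _ _ fun x hx => by
      have := (mem_sdiff.mp hx).1
      simp only [hr, mem_range] at this
      omega
  have h3 := sum_inter_add_sum_sdiff s r (fun x => x)
  have h4 := sum_inter_add_sum_sdiff r s (fun x => x)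
  rw [inter_comm] at h4
  simp only [sum_add_distrib, sum_const, smul_eq_mul, mul_one] at h2
  have h5 : #(s \ r) = 0 := by rw [← hc] at h2; omega
  exact eq_of_subset_of_card_le (sdiff_eq_empty_iff_subset.mp (card_eq_zero.mp h5)) (by simp [hr])

theorem sum_range_two_mul_add_one (d : ℕ) : 2 * (∑ x ∈ range d, x) + d = d ^ 2 := by
  induction d with
  | zero => simp
  | succ n ih => rw [sum_range_succ]; linarith

/-- Pairwise distinct odd naturals with sum at most `d ^ 2` are `1, 3, …, 2 * d - 1` in some
order. -/
theorem exists_perm_of_odd_of_injective {d : ℕ} {m : Fin d → ℕ} (hodd : ∀ i, Odd (m i))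
    (hinj : Function.Injective m) (hsum : ∑ i, m i ≤ d ^ 2) :
    ∃ τ : Equiv.Perm (Fin d), ∀ i, m i = 2 * (τ i : ℕ) + 1 := by
  choose u hu using hodd
  have hui : Function.Injective u := fun i j h => hinj (by rw [hu i, hu j, h])
  have hc : #(univ.image u) = d := by rw [card_image_of_injective _ hui]; simp
  have hs : ∑ x ∈ univ.image u, x = ∑ i, u i := sum_image fun i _ j _ h => hui h
  have h1 : ∑ i, m i = 2 * ∑ i, u i + d := by
    simp [hu, sum_add_distrib, mul_sum]
  have h2 := eq_range_of_sum_le (s := univ.image u) (by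
    rw [hc, hs]
    have := sum_range_two_mul_add_one d
    omega)
  rw [hc] at h2
  have hlt : ∀ i, u i < d := fun i => by
    rw [← mem_range, ← h2]; exact mem_image_of_mem u (mem_univ i)
  have hfi : Function.Injective fun i => (⟨u i, hlt i⟩ : Fin d) :=
    fun i j h => hui (by simpa using h)
  exact ⟨Equiv.ofBijective _ (Finite.injective_iff_bijective.mp hfi), fun i => by simp [hu]⟩

theorem sum_fin_two_mul_add_one (d : ℕ) : ∑ i : Fin d, (2 * (i : ℕ) + 1) = d ^ 2 := by
  rw [Fin.sum_univ_eq_sum_range (fun i => 2 * i + 1), sum_add_distrib, ← mul_sum]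
  simpa using sum_range_two_mul_add_one d

theorem exists_perm_of_summand_ne_zero {K : Type*} [Field K] {d : ℕ} {a : Fin d → K}
    {e m : Fin d → ℕ} (hsum : ∑ i, m i ≤ d ^ 2)
    (h : (∏ i, (if Odd (m i) then 2 else 0) * a i ^ m i) *
          (Matrix.of fun j i => invFactorialSub K (m i) (e j)).det ≠ 0) :
    ∃ τ : Equiv.Perm (Fin d), ∀ i, m i = 2 * (τ i : ℕ) + 1 := by
  refine exists_perm_of_odd_of_injective (fun i => ?_) (fun i j hij => ?_) hsum
  · by_contra hi
    exact h (by rw [prod_eq_zero (mem_univ i) (by simp [hi]), zero_mul])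
  · by_contra hne
    exact h (by rw [Matrix.det_zero_of_column_eq hne (fun l => by simp [hij]), mul_zero])

theorem sum_signs_eq_zero {K : Type*} [Field K] {d k : ℕ} (hk : (k.factorial : K) ≠ 0)
    (a : Fin d → K) {e : Fin d → ℕ} (hlt : k + ∑ i, e i < d ^ 2) :
    ∑ ε : Fin d → ℤˣ, (∏ i, ((ε i : ℤ) : K)) * (∑ i, ((ε i : ℤ) : K) * a i) ^ k *
        (Matrix.of fun j i => (((ε i : ℤ) : K) * a i) ^ e j).det = 0 := by
  rw [sum_signs_mul_pow_mul_det hk, sum_eq_zero, mul_zero]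
  intro m hm
  by_contra h
  have hs : ∑ i, m i = _ := (mem_piAntidiag.mp hm).1
  obtain ⟨τ, hτ⟩ := exists_perm_of_summand_ne_zero (by omega) h
  have : ∑ i, m i = d ^ 2 := by
    simp only [hτ]
    rw [Equiv.sum_comp τ (fun i => 2 * (i : ℕ) + 1), sum_fin_two_mul_add_one]
  omega

theorem sum_signs_eq_det_mul_det {K : Type*} [Field K] {d k : ℕ} (hk : (k.factorial : K) ≠ 0)
    (a : Fin d → K) {e : Fin d → ℕ} (heq : k + ∑ i, e i = d ^ 2) :
    ∑ ε : Fin d → ℤˣ, (∏ i, ((ε i : ℤ) : K)) * (∑ i, ((ε i : ℤ) : K) * a i) ^ k *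
        (Matrix.of fun j i => (((ε i : ℤ) : K) * a i) ^ e j).det =
      k.factorial * (2 ^ d * (Matrix.of fun j i : Fin d => invFactorialSub K (2 * (i : ℕ) + 1) (e j)).det *
        (Matrix.of fun j i : Fin d => a i ^ (2 * (j : ℕ) + 1)).det) := by
  rw [sum_signs_mul_pow_mul_det hk, heq]
  congr 1
  rw [Matrix.det_apply' (Matrix.of fun j i : Fin d => a i ^ (2 * (j : ℕ) + 1)), mul_sum]
  symm
  refine sum_of_injOn (fun (τ : Equiv.Perm (Fin d)) i => 2 * (τ i : ℕ) + 1) ?_ ?_ ?_ ?_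
  · intro τ _ τ' _ h
    ext i
    have := congrFun h i
    simpa using this
  · intro τ _
    simp only [mem_coe, mem_piAntidiag]
    refine ⟨?_, by simp⟩
    rw [Equiv.sum_comp τ (fun i => 2 * (i : ℕ) + 1), sum_fin_two_mul_add_one]
  · intro m hm hm'
    by_contra h
    obtain ⟨τ, hτ⟩ := exists_perm_of_summand_ne_zero (mem_piAntidiag.mp hm).1.le h
    exact hm' ⟨τ, by simp, (funext hτ).symm⟩
  · intro τ _
    have h := Matrix.det_permute' τ
      (Matrix.of fun j i : Fin d => invFactorialSub K (2 * (i : ℕ) + 1) (e j))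
    have h' : (Matrix.of fun j i : Fin d => invFactorialSub K (2 * (τ i : ℕ) + 1) (e j)).det = _ := h
    rw [h']
    simp [prod_mul_distrib]
    ring

/-- The coefficients of `∏ l < d, (X - (2 * l + 1))` in the basis of falling factorials. -/
def oddFallingCoeff : ℕ → ℕ → ℤ
  | 0, 0 => 1
  | 0, _ + 1 => 0
  | d + 1, 0 => -(2 * d + 1) * oddFallingCoeff d 0
  | d + 1, s + 1 => oddFallingCoeff d s + (s - 2 * d) * oddFallingCoeff d (s + 1)

theorem oddFallingCoeff_eq_zero {d s : ℕ} (h : d < s) : oddFallingCoeff d s = 0 := by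
  induction d generalizing s with
  | zero => cases s with
    | zero => omega
    | succ s => rfl
  | succ d ih => cases s with
    | zero => omega
    | succ s => simp [oddFallingCoeff, ih (show d < s by omega), ih (show d < s + 1 by omega)]

theorem sum_oddFallingCoeff_mul_descFactorial (d x : ℕ) :
    ∑ s ∈ range (d + 1), oddFallingCoeff d s * (x.descFactorial s : ℤ) =
      ∏ l ∈ range d, ((x : ℤ) - (2 * l + 1)) := by
  have hx : ∀ s : ℕ, (x.descFactorial (s + 1) : ℤ) = (x - s) * x.descFactorial s := by
    intro s
    rw [Nat.descFactorial_succ]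
    rcases le_or_gt s x with h | h
    · push_cast [h]; rfl
    · simp [Nat.descFactorial_of_lt h]
  induction d with
  | zero => simp [oddFallingCoeff]
  | succ d ih =>
    rw [prod_range_succ, ← ih, sum_range_succ']
    have h1 : ∑ s ∈ range (d + 1), oddFallingCoeff (d + 1) (s + 1) * (x.descFactorial (s + 1) : ℤ) =
        ∑ s ∈ range (d + 1), oddFallingCoeff d s * (x - s) * (x.descFactorial s : ℤ) +
        ∑ s ∈ range (d + 1), (((s + 1 : ℕ) : ℤ) - (2 * d + 1)) * oddFallingCoeff d (s + 1) *
          (x.descFactorial (s + 1) : ℤ) := by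
      rw [← sum_add_distrib]
      refine sum_congr rfl fun s _ => ?_
      simp only [oddFallingCoeff]
      rw [add_mul, hx]
      push_cast
      ring
    have h2 := sum_range_succ' (fun s : ℕ => ((s : ℤ) - (2 * d + 1)) * oddFallingCoeff d s *
          (x.descFactorial s : ℤ)) (d + 1)
    rw [sum_range_succ, oddFallingCoeff_eq_zero (Nat.lt_succ_self d)] at h2
    rw [h1, sum_mul]
    have h3 : ∑ s ∈ range (d + 1), oddFallingCoeff d s * (x.descFactorial s : ℤ) *
          (x - (2 * d + 1)) =
        ∑ s ∈ range (d + 1), oddFallingCoeff d s * (x - s) * (x.descFactorial s : ℤ) +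
        ∑ s ∈ range (d + 1), ((s : ℤ) - (2 * d + 1)) * oddFallingCoeff d s *
          (x.descFactorial s : ℤ) := by
      rw [← sum_add_distrib]
      exact sum_congr rfl fun s _ => by ring
    rw [h3]
    simp only [oddFallingCoeff]
    push_cast at h2 ⊢
    linarith

theorem oddFallingCoeff_mul_factorial (s r : ℕ) :
    oddFallingCoeff (s + r) s * (s.factorial * r.factorial * 2 ^ r) =
      (-1) ^ r * (2 * r + s).factorial := by
  obtain ⟨d, hd⟩ : ∃ d, d = s + r := ⟨_, rfl⟩
  induction d generalizing s r with
  | zero =>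
    obtain ⟨rfl, rfl⟩ : s = 0 ∧ r = 0 := by omega
    simp [oddFallingCoeff]
  | succ d ih =>
    rcases s with _ | s <;> rcases r with _ | r
    · omega
    · have h := ih 0 r (by omega)
      obtain rfl : d = r := by omega
      have e1 : 2 * (d + 1) + 0 = (2 * d + 1) + 1 := by ring
      rw [e1, Nat.factorial_succ (2 * d + 1), Nat.factorial_succ (2 * d), Nat.factorial_succ d]
      have e2 : oddFallingCoeff (d + 1) 0 = -(2 * d + 1) * oddFallingCoeff d 0 := rfl
      simp only [zero_add, add_zero, e2] at h ⊢
      push_cast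
      linear_combination (-(2 * (d : ℤ) + 1) * (d + 1) * 2) * h
    · have h := ih s 0 (by omega)
      simp only [add_zero, oddFallingCoeff] at h ⊢
      rw [oddFallingCoeff_eq_zero (Nat.lt_succ_self s)]
      simp only [mul_zero, zero_add, Nat.factorial_succ] at h ⊢
      push_cast
      linear_combination ((s : ℤ) + 1) * h
    · have h1 := ih s (r + 1) (by omega)
      have h2 := ih (s + 1) r (by omega)
      have e1 : s + 1 + (r + 1) = (s + r + 1) + 1 := by ring
      have e2 : s + (r + 1) = s + r + 1 := by ring
      have e3 : s + 1 + r = s + r + 1 := by ring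
      have e4 : 2 * (r + 1) + (s + 1) = (2 * r + s + 2) + 1 := by ring
      have e5 : 2 * (r + 1) + s = (2 * r + s + 1) + 1 := by ring
      have e6 : 2 * r + (s + 1) = 2 * r + s + 1 := by ring
      rw [e1]
      rw [e2, e5] at h1
      rw [e3, e6] at h2
      have e7 : oddFallingCoeff (s + r + 1 + 1) (s + 1) = oddFallingCoeff (s + r + 1) s +
          (s - 2 * (s + r + 1 : ℕ)) * oddFallingCoeff (s + r + 1) (s + 1) := rfl
      rw [e4, e7]
      rw [Nat.factorial_succ (2 * r + s + 2)]
      rw [Nat.factorial_succ (2 * r + s + 1)] at h1 ⊢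
      rw [Nat.factorial_succ r] at h1 ⊢
      rw [Nat.factorial_succ s] at h2 ⊢
      push_cast at h1 h2 ⊢
      linear_combination ((s : ℤ) + 1) * h1 - (2 * r + s + 2) * (r + 1) * 2 * h2

theorem factorial_cast_ne_zero {p m : ℕ} [Fact p.Prime] (hm : m < p) :
    (m.factorial : ZMod p) ≠ 0 := by
  rw [Ne, ZMod.natCast_eq_zero_iff, (Fact.out : p.Prime).dvd_factorial]
  omega

theorem zmod_two_ne_zero {p : ℕ} [Fact p.Prime] (hp : 2 < p) : (2 : ZMod p) ≠ 0 := by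
  simpa using factorial_cast_ne_zero hp

theorem oddFallingCoeff_cast_ne_zero {p d s : ℕ} (hp : p.Prime) (hd : 2 * d < p) (hs : s ≤ d) :
    (oddFallingCoeff d s : ZMod p) ≠ 0 := by
  have := Fact.mk hp
  obtain ⟨r, rfl⟩ := Nat.exists_eq_add_of_le hs
  intro h
  have h1 := congrArg (Int.cast : ℤ → ZMod p) (oddFallingCoeff_mul_factorial s r)
  push_cast at h1
  rw [h, zero_mul] at h1
  have h2 : (((2 * r + s).factorial : ℕ) : ZMod p) ≠ 0 :=
    factorial_cast_ne_zero (by omega)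
  exact mul_ne_zero (pow_ne_zero _ (neg_ne_zero.mpr one_ne_zero)) h2 h1.symm

theorem oddFallingCoeff_self (d : ℕ) : oddFallingCoeff d d = 1 := by
  induction d with
  | zero => rfl
  | succ d ih => simp [oddFallingCoeff, ih, oddFallingCoeff_eq_zero (Nat.lt_succ_self d)]

theorem det_descFactorial_ne_zero {K : Type*} [Field K] {d : ℕ} {x : Fin d → ℕ}
    (hx : Function.Injective fun i => (x i : K)) :
    (Matrix.of fun i j : Fin d => ((x i).descFactorial j : K)).det ≠ 0 := by
  have h := Matrix.det_eval_matrixOfPolynomials_eq_det_vandermonde (fun i => (x i : K))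
    (fun i => descPochhammer K i) (fun i => descPochhammer_natDegree K i)
    (fun i => monic_descPochhammer K i)
  simp only [descPochhammer_eval_eq_descFactorial] at h
  rw [← h]
  exact Matrix.det_vandermonde_ne_zero_iff.mpr hx

theorem injective_two_mul_add_one_cast {p d : ℕ} (hd : 2 * d < p) :
    Function.Injective fun i : Fin d => ((2 * (i : ℕ) + 1 : ℕ) : ZMod p) := by
  intro i j h
  have h' := (ZMod.natCast_eq_natCast_iff' _ _ _).mp h
  rw [Nat.mod_eq_of_lt (by omega), Nat.mod_eq_of_lt (by omega)] at h'
  ext; omega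

theorem det_descFactorial_succAbove_ne_zero {p d : ℕ} (hp : p.Prime) (hd : 2 * d < p)
    (s : Fin (d + 1)) :
    (Matrix.of fun i j : Fin d =>
      ((2 * (i : ℕ) + 1).descFactorial (s.succAbove j) : ZMod p)).det ≠ 0 := by
  have := Fact.mk hp
  intro h
  obtain ⟨v, hv0, hv⟩ := Matrix.exists_mulVec_eq_zero_iff.mpr h
  set b : Fin (d + 1) → ZMod p := fun t => oddFallingCoeff d t with hb
  set v' : Fin (d + 1) → ZMod p := s.insertNth 0 v with hv'
  have kv : ∀ i : Fin d, ∑ t : Fin (d + 1), ((2 * (i : ℕ) + 1).descFactorial t : ZMod p) * v' t = 0 := by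
    intro i
    rw [Fin.sum_univ_succAbove _ s]
    simpa [hv', Matrix.mulVec, dotProduct] using congrFun hv i
  have kb : ∀ i : Fin d, ∑ t : Fin (d + 1), ((2 * (i : ℕ) + 1).descFactorial t : ZMod p) * b t = 0 := by
    intro i
    have h1 := congrArg (Int.cast : ℤ → ZMod p)
      (sum_oddFallingCoeff_mul_descFactorial d (2 * (i : ℕ) + 1))
    rw [prod_eq_zero (mem_range.mpr i.2) (by push_cast; ring), ← Fin.sum_univ_eq_sum_range
      (fun s => oddFallingCoeff d s * ((2 * (i : ℕ) + 1).descFactorial s : ℤ))] at h1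
    push_cast at h1
    rw [← h1]
    exact sum_congr rfl fun t _ => by simp [hb, mul_comm]
  have hlast : b (Fin.last d) = 1 := by simp [hb, oddFallingCoeff_self]
  have hprop : ∀ t, v' t = v' (Fin.last d) * b t := by
    have hu : (fun j : Fin d => v' j.castSucc - v' (Fin.last d) * b j.castSucc) = 0 := by
      refine Matrix.eq_zero_of_mulVec_eq_zero
        (det_descFactorial_ne_zero (injective_two_mul_add_one_cast hd)) (funext fun i => ?_)
      have h1 := kv i
      have h2 := kb i
      rw [Fin.sum_univ_castSucc] at h1 h2
      simp only [Matrix.mulVec, dotProduct, Matrix.of_apply, mul_sub, sum_sub_distrib,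
        Pi.zero_apply]
      simp only [hlast, Fin.val_castSucc, Fin.val_last, mul_left_comm _ (v' (Fin.last d)),
        ← mul_sum] at h1 h2 ⊢
      linear_combination h1 - v' (Fin.last d) * h2
    intro t
    refine Fin.lastCases ?_ (fun j => ?_) t
    · rw [hlast, mul_one]
    · exact sub_eq_zero.mp (congrFun hu j)
  have hbs : b s ≠ 0 := oddFallingCoeff_cast_ne_zero hp hd (Nat.lt_succ_iff.mp s.2)
  have hz : v' (Fin.last d) = 0 := by
    have h1 := hprop s
    simp only [hv', Fin.insertNth_apply_same] at h1
    exact (mul_eq_zero.mp h1.symm).resolve_right hbs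
  apply hv0
  funext j
  have h1 := hprop (s.succAbove j)
  rw [hz, zero_mul] at h1
  simpa [hv'] using h1

theorem invFactorialSub_eq_inv_factorial_mul {p m : ℕ} [Fact p.Prime] (hm : m < p) (e : ℕ) :
    invFactorialSub (ZMod p) m e = ((m.factorial : ZMod p))⁻¹ * m.descFactorial e := by
  have hf : (m.factorial : ZMod p) ≠ 0 := factorial_cast_ne_zero hm
  unfold invFactorialSub
  split_ifs with h
  · rw [← Nat.factorial_mul_descFactorial h] at hf ⊢
    push_cast at hf ⊢
    have h1 := left_ne_zero_of_mul hf
    have h2 := right_ne_zero_of_mul hf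
    field_simp
  · simp [Nat.descFactorial_of_lt (not_le.mp h)]

theorem det_invFactorialSub_succAbove_ne_zero {p d : ℕ} [Fact p.Prime] (hd : 2 * d < p)
    (s : Fin (d + 1)) :
    (Matrix.of fun j i : Fin d =>
      invFactorialSub (ZMod p) (2 * (i : ℕ) + 1) (s.succAbove j)).det ≠ 0 := by
  have h : (Matrix.of fun j i : Fin d =>
      invFactorialSub (ZMod p) (2 * (i : ℕ) + 1) (s.succAbove j)) =
      Matrix.of fun j i : Fin d => (((2 * (i : ℕ) + 1).factorial : ZMod p))⁻¹ *
        (Matrix.of fun i j : Fin d =>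
          ((2 * (i : ℕ) + 1).descFactorial (s.succAbove j) : ZMod p)).transpose j i := by
    ext j i
    exact invFactorialSub_eq_inv_factorial_mul (by omega) _
  rw [h, Matrix.det_mul_row, Matrix.det_transpose]
  refine mul_ne_zero (prod_ne_zero_iff.mpr fun i _ => inv_ne_zero (factorial_cast_ne_zero (by omega)))
    (det_descFactorial_succAbove_ne_zero Fact.out hd s)

theorem det_odd_pow_ne_zero {K : Type*} [Field K] {d : ℕ} {a : Fin d → K} (ha : ∀ i, a i ≠ 0)
    (hsq : Function.Injective fun i => a i ^ 2) :
    (Matrix.of fun j i : Fin d => a i ^ (2 * (j : ℕ) + 1)).det ≠ 0 := by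
  have h : (Matrix.of fun j i : Fin d => a i ^ (2 * (j : ℕ) + 1)) =
      Matrix.of fun j i : Fin d =>
        a i * (Matrix.vandermonde fun i => a i ^ 2).transpose j i := by
    ext j i
    simp [Matrix.vandermonde_apply]
    ring
  rw [h, Matrix.det_mul_row, Matrix.det_transpose]
  exact mul_ne_zero (prod_ne_zero_iff.mpr fun i _ => ha i)
    (Matrix.det_vandermonde_ne_zero_iff.mpr hsq)

theorem exists_signed_sum_eq {p d : ℕ} [Fact p.Prime] {a : Fin d → ZMod p} (ha : ∀ i, a i ≠ 0)
    (hsq : Function.Injective fun i => a i ^ 2) (hd : 2 * d < p)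
    (hlow : ∑ x ∈ range d, x < p) (hhigh : p ≤ ∑ x ∈ range (d + 1), x) (c : ZMod p) :
    ∃ ε : Fin d → ℤˣ, ∑ i, ((ε i : ℤ) : ZMod p) * a i = c := by
  have hp : p.Prime := Fact.out
  by_contra! hc
  have hsum := sum_range_two_mul_add_one d
  rw [sum_range_succ] at hhigh
  obtain ⟨s, hs⟩ : ∃ s : Fin (d + 1), p - 1 - ∑ x ∈ range d, x = s :=
    ⟨⟨p - 1 - ∑ x ∈ range d, x, by omega⟩, rfl⟩
  set e : Fin d → ℕ := fun j => s.succAbove j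
  have he : p - 1 + ∑ j, e j = d ^ 2 := by
    have h := Fin.sum_univ_succAbove (fun i : Fin (d + 1) => (i : ℕ)) s
    rw [Fin.sum_univ_eq_sum_range (fun i => i), sum_range_succ] at h
    change _ = _ + ∑ j, e j at h
    have := hp.pos
    omega
  have hfac : ∀ k < p, (k.factorial : ZMod p) ≠ 0 := fun k hk => factorial_cast_ne_zero hk
  have hzero : ∀ k < p - 1,
      ∑ ε : Fin d → ℤˣ, (∏ i, ((ε i : ℤ) : ZMod p)) * (∑ i, ((ε i : ℤ) : ZMod p) * a i) ^ k *
        (Matrix.of fun j i => (((ε i : ℤ) : ZMod p) * a i) ^ e j).det = 0 := fun k hk =>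
    sum_signs_eq_zero (hfac k (by omega)) a (by omega)
  have htop := sum_signs_eq_det_mul_det (hfac (p - 1) (by have := hp.pos; omega)) a he
  have hshift : ∑ ε : Fin d → ℤˣ, (∏ i, ((ε i : ℤ) : ZMod p)) *
        (∑ i, ((ε i : ℤ) : ZMod p) * a i + -c) ^ (p - 1) *
        (Matrix.of fun j i => (((ε i : ℤ) : ZMod p) * a i) ^ e j).det =
      ∑ ε : Fin d → ℤˣ, (∏ i, ((ε i : ℤ) : ZMod p)) *
        (∑ i, ((ε i : ℤ) : ZMod p) * a i) ^ (p - 1) *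
        (Matrix.of fun j i => (((ε i : ℤ) : ZMod p) * a i) ^ e j).det := by
    simp only [add_pow, mul_sum, sum_mul]
    rw [sum_comm, sum_range_succ, sum_eq_zero, zero_add]
    · simp
    · intro k hk
      have h := congrArg (fun z => z * ((-c) ^ (p - 1 - k) * ((p - 1).choose k : ZMod p)))
        (hzero k (mem_range.mp hk))
      simp only [zero_mul, sum_mul] at h
      rw [← h]
      exact sum_congr rfl fun ε _ => by ring
  have hone : ∀ ε : Fin d → ℤˣ, (∑ i, ((ε i : ℤ) : ZMod p) * a i + -c) ^ (p - 1) = 1 := fun ε =>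
    ZMod.pow_card_sub_one_eq_one (by rw [← sub_eq_add_neg]; exact sub_ne_zero.mpr (hc ε))
  have hd0 : d ≠ 0 := by
    rintro rfl
    have hp0 := hp.pos
    simp at hhigh
    omega
  have h0 := hzero 0 (by omega)
  simp only [hone, pow_zero] at hshift h0
  rw [← hshift, h0] at htop
  refine mul_ne_zero (hfac (p - 1) (by have := hp.pos; omega)) (mul_ne_zero (mul_ne_zero
    (pow_ne_zero _ ?_) (det_invFactorialSub_succAbove_ne_zero hd s))
    (det_odd_pow_ne_zero ha hsq)) htop.symm
  exact zmod_two_ne_zero (by omega)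

theorem two_mul_card_lt_of_neg_notMem {p : ℕ} [NeZero p] {A : Finset (ZMod p)}
    (hA : ∀ a ∈ A, -a ∉ A) : 2 * #A < p := by
  have h0 : (0 : ZMod p) ∉ A := fun h => hA 0 h (by simpa using h)
  have hdisj : Disjoint A (A.map (Equiv.neg _).toEmbedding) := by
    rw [disjoint_left]
    intro a ha hmap
    obtain ⟨b, hb, rfl⟩ := mem_map.mp hmap
    exact hA b hb ha
  have h := card_lt_univ_of_notMem (s := A ∪ A.map (Equiv.neg _).toEmbedding) (x := 0) (by
    simp [h0])
  rw [card_union_of_disjoint hdisj, card_map, ZMod.card] at h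
  omega

theorem exists_subset_sum_eq {p : ℕ} [Fact p.Prime] {B : Finset (ZMod p)}
    (hB : ∀ b ∈ B, -b ∉ B) (hlow : ∑ x ∈ range #B, x < p)
    (hhigh : p ≤ ∑ x ∈ range (#B + 1), x) (x : ZMod p) : ∃ S ⊆ B, S.sum id = x := by
  have hd := two_mul_card_lt_of_neg_notMem hB
  set a : Fin #B → ZMod p := fun i => B.equivFin.symm i with ha
  have hmem : ∀ i, a i ∈ B := fun i => (B.equivFin.symm i).2
  have hinj : Function.Injective a := Subtype.val_injective.comp B.equivFin.symm.injective
  have himg : univ.image a = B := eq_of_subset_of_card_le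
    (image_subset_iff.mpr fun i _ => hmem i) (by rw [card_image_of_injective _ hinj]; simp)
  obtain ⟨ε, hε⟩ := exists_signed_sum_eq (a := a)
    (fun i h => hB 0 (h ▸ hmem i) (by simpa using h ▸ hmem i))
    (fun i j h => by
      rcases sq_eq_sq_iff_eq_or_eq_neg.mp h with h | h
      · exact hinj h
      · exact absurd (h ▸ hmem i) (hB _ (hmem j)))
    hd hlow hhigh (2 * x - ∑ i, a i)
  have hB0 : #B ≠ 0 := by
    intro h
    have hp0 := (Fact.out : p.Prime).pos
    simp [h] at hhigh
    omega
  have h2 : (2 : ZMod p) ≠ 0 := zmod_two_ne_zero (by omega)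
  refine ⟨({i | ε i = 1} : Finset _).image a, image_subset_iff.mpr fun i _ => hmem i,
    mul_left_cancel₀ h2 ?_⟩
  rw [sum_image fun i _ j _ h => hinj h, sum_filter, ← sub_add_cancel (2 * x) (∑ i, a i), ← hε,
    mul_sum, ← sum_add_distrib]
  refine sum_congr rfl fun i _ => ?_
  rcases Int.units_eq_one_or (ε i) with h | h
  · simp [h]; ring
  · simp [h]

theorem subset_sums_cover (p : ℕ) (hp : p.Prime) (A : Finset (ZMod p))
    (hA : ∀ a ∈ A, -a ∉ A) (hbig : p ≤ A.card * (A.card + 1) / 2) :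
    ∀ x : ZMod p, x ∈ A.powerset.image fun S => S.sum id := by
  have := Fact.mk hp
  intro x
  have hex : ∃ d, p ≤ ∑ x ∈ range (d + 1), x :=
    ⟨#A, by rw [sum_range_id, add_tsub_cancel_right, mul_comm]; exact hbig⟩
  classical
  have hle : Nat.find hex ≤ #A := Nat.find_min' hex
    (by rw [sum_range_id, add_tsub_cancel_right, mul_comm]; exact hbig)
  obtain ⟨B, hBA, hcard⟩ := exists_subset_card_eq hle
  have hhigh := Nat.find_spec hex
  have hlow : ∑ x ∈ range (Nat.find hex), x < p := by
    rcases h : Nat.find hex with _ | n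
    · simpa using hp.pos
    · exact not_le.mp (Nat.find_min hex (m := n) (by omega))
  rw [← hcard] at hhigh hlow
  obtain ⟨S, hS, hsum⟩ := exists_subset_sum_eq
    (fun b hb h => hA b (hBA hb) (hBA h)) hlow hhigh x
  exact mem_image.mpr ⟨S, mem_powerset.mpr (hS.trans hBA), hsum⟩
end

section
/- Let p be a prime and A ⊆ F_p nonempty with A ∩ (-A) = ∅ and |A|(|A|+1)/2 ≥ p. Then 0 ∈ Σ*(A), i.e., A admits a nonempty zero-sum subset. -/
/-- The coefficients of `∏ j < d, (X - (2 * j + 1))` in the basis of falling factorials. -/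
def oddProdCoeff (R : Type*) [CommRing R] : ℕ → ℕ → R
  | 0, 0 => 1
  | 0, _ + 1 => 0
  | d + 1, 0 => -(2 * d + 1) * oddProdCoeff R d 0
  | d + 1, k + 1 => oddProdCoeff R d k + (k - 2 * d) * oddProdCoeff R d (k + 1)

section oddProdCoeff

variable {R : Type*} [CommRing R]

theorem oddProdCoeff_of_lt {d k : ℕ} (h : d < k) : oddProdCoeff R d k = 0 := by
  induction d generalizing k with
  | zero =>
    obtain ⟨k, rfl⟩ := Nat.exists_eq_add_of_lt h
    simp [oddProdCoeff]
  | succ d ih =>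
    obtain ⟨k, rfl⟩ := Nat.exists_eq_add_of_lt (Nat.zero_lt_of_lt h)
    simp [oddProdCoeff, ih (show d < k by lia), ih (show d < k + 1 by lia)]

theorem oddProdCoeff_self (d : ℕ) : oddProdCoeff R d d = 1 := by
  induction d with
  | zero => rfl
  | succ d ih => simp [oddProdCoeff, ih, oddProdCoeff_of_lt]

theorem oddProdCoeff_mul_factorial (k j : ℕ) :
    2 ^ j * j.factorial * k.factorial * oddProdCoeff R (k + j) k =
      (-1) ^ j * (k + 2 * j).factorial := by
  induction h : k + j generalizing k j with
  | zero =>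
    obtain ⟨rfl, rfl⟩ : k = 0 ∧ j = 0 := by lia
    simp [oddProdCoeff]
  | succ d ih =>
    rcases j with _ | j
    · obtain rfl : k = d + 1 := by lia
      simp [oddProdCoeff_self]
    · rcases k with _ | k
      · obtain rfl : d = j := by lia
        have := ih 0 d (by lia)
        simp only [oddProdCoeff, Nat.factorial_succ, zero_add, mul_add, mul_one, pow_succ,
          Nat.factorial_zero] at this ⊢
        push_cast at this ⊢
        linear_combination (-(2 * d + 1) * 2 * (d + 1) : R) * this
      · obtain rfl : d = k + 1 + j := by lia
        have h₁ := ih k (j + 1) (by lia)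
        have h₂ := ih (k + 1) j (by lia)
        simp only [oddProdCoeff]
        rw [show k + 2 * (j + 1) = k + 1 + 2 * j + 1 by ring] at h₁
        rw [show k + 1 + 2 * (j + 1) = k + 1 + 2 * j + 1 + 1 by ring]
        simp only [Nat.factorial_succ, pow_succ] at h₁ h₂ ⊢
        push_cast at h₁ h₂ ⊢
        linear_combination (k + 1 : R) * h₁ - (2 * (j + 1) * (k + 2 * j + 2) : R) * h₂

open Polynomial in
theorem prod_X_sub_odd (d : ℕ) :
    ∏ j ∈ Finset.range d, (X - C (2 * j + 1 : R)) =
      ∑ k ∈ Finset.range (d + 1), C (oddProdCoeff R d k) * descPochhammer R k := by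
  induction d with
  | zero => simp [oddProdCoeff]
  | succ d ih =>
    set g : ℕ → R[X] := fun k =>
      C ((k - (2 * d + 1)) * oddProdCoeff R d k) * descPochhammer R k with hg
    have hmul (k : ℕ) : C (oddProdCoeff R d k) * descPochhammer R k * (X - C (2 * d + 1 : R)) =
        C (oddProdCoeff R d k) * descPochhammer R (k + 1) + g k := by
      rw [descPochhammer_succ_right, hg]
      simp only [map_sub, map_natCast, map_mul]
      ring
    have hsucc (k : ℕ) : C (oddProdCoeff R (d + 1) (k + 1)) * descPochhammer R (k + 1) =
        C (oddProdCoeff R d k) * descPochhammer R (k + 1) + g (k + 1) := by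
      have : (((k + 1 : ℕ) : R) - (2 * d + 1)) = k - 2 * d := by push_cast; ring
      rw [hg]
      simp only [oddProdCoeff, this, C_add]
      ring
    have hzero : C (oddProdCoeff R (d + 1) 0) * descPochhammer R 0 = g 0 := by
      simp [hg, oddProdCoeff]
    have hlast : g (d + 1) = 0 := by simp [hg, oddProdCoeff_of_lt]
    rw [Finset.prod_range_succ, ih, Finset.sum_mul, Finset.sum_congr rfl fun k _ => hmul k,
      Finset.sum_range_succ' _ (d + 1), Finset.sum_congr rfl fun k _ => hsucc k, hzero,
      Finset.sum_add_distrib, Finset.sum_add_distrib, add_assoc, ← Finset.sum_range_succ' g,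
      Finset.sum_range_succ g (d + 1), hlast, add_zero]

end oddProdCoeff

open Polynomial in
theorem eq_zero_of_forall_sum_descFactorial_odd {F : Type*} [Field F] {d : ℕ}
    (hd : ((2 * d).factorial : F) ≠ 0) (u : Fin (d + 1) → F) (k : Fin (d + 1)) (hk : u k = 0)
    (hu : ∀ j < d, ∑ l, u l * ((2 * j + 1).descFactorial l : F) = 0) : u = 0 := by
  have hcast (n : ℕ) (hn : 0 < n) (hnd : n ≤ 2 * d) : (n : F) ≠ 0 := fun h =>
    hd (by obtain ⟨c, hc⟩ := Nat.dvd_factorial hn hnd; rw [hc, Nat.cast_mul, h, zero_mul])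
  have hb : oddProdCoeff F d k ≠ 0 := by
    intro h
    have := oddProdCoeff_mul_factorial (R := F) k (d - k)
    rw [show (k : ℕ) + (d - k) = d by lia, h, mul_zero] at this
    have h' : (((k : ℕ) + 2 * (d - k)).factorial : F) = 0 := by
      simpa using this.symm
    obtain ⟨c, hc⟩ := Nat.factorial_dvd_factorial (show (k : ℕ) + 2 * (d - k) ≤ 2 * d by lia)
    exact hd (by rw [hc, Nat.cast_mul, h', zero_mul])
  have hdeg (n : ℕ) : (descPochhammer F n).degree = n := by
    rw [degree_eq_natDegree (monic_descPochhammer F n).ne_zero, descPochhammer_natDegree]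
  set w : Fin (d + 1) → F := fun l => u l - u (Fin.last d) * oddProdCoeff F d l with hw
  set P : F[X] := ∑ l, C (w l) * descPochhammer F l with hP
  have hPdeg : P.degree < d := by
    rw [hP, Fin.sum_univ_castSucc]
    simp only [hw, Fin.val_last, oddProdCoeff_self, mul_one, sub_self, C_0, zero_mul, add_zero]
    refine mem_degreeLT.mp (Submodule.sum_mem _ fun i _ => ?_)
    rw [← smul_eq_C_mul]
    refine Submodule.smul_mem _ _ (mem_degreeLT.mpr ?_)
    rw [hdeg]
    exact_mod_cast i.isLt
  have hP0 : P = 0 := by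
    refine eq_zero_of_degree_lt_of_eval_index_eq_zero (s := Finset.range d)
      (v := fun j : ℕ => (2 * j + 1 : F)) ?_ (by simpa using hPdeg) ?_
    · intro i hi j hj hij
      simp only [Finset.coe_range, Set.mem_Iio] at hi hj
      by_contra hne
      wlog hlt : i < j generalizing i j
      · exact this hij.symm hj hi (Ne.symm hne) (by lia)
      refine hcast (2 * (j - i)) (by lia) (by lia) ?_
      rw [Nat.cast_mul, Nat.cast_sub hlt.le]
      push_cast
      have hij' : (2 * i + 1 : F) = 2 * j + 1 := hij
      linear_combination -hij'
    · intro j hj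
      have hprod := congrArg (eval (2 * j + 1 : F)) (prod_X_sub_odd (R := F) d)
      rw [eval_prod, Finset.prod_eq_zero hj (by simp), eval_finsetSum,
        ← Fin.sum_univ_eq_sum_range
          (fun l => eval (2 * j + 1 : F) (C (oddProdCoeff F d l) * descPochhammer F l))] at hprod
      have hj' := hu j (Finset.mem_range.mp hj)
      simp_rw [← descPochhammer_eval_eq_descFactorial] at hj'
      push_cast at hj'
      simp only [eval_mul, eval_C] at hprod
      simp only [hP, hw, eval_finsetSum, eval_mul, eval_C, sub_mul, Finset.sum_sub_distrib, hj',
        mul_assoc, ← Finset.mul_sum, ← hprod, mul_zero, sub_zero]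
  have hw0 : w = 0 := by
    have hli := (Sequence.linearIndependent ⟨descPochhammer F, hdeg⟩).comp
      (Fin.val : Fin (d + 1) → ℕ) Fin.val_injective
    ext l
    refine Fintype.linearIndependent_iff.mp hli w ?_ l
    rw [← hP0, hP]
    exact Finset.sum_congr rfl fun l _ => smul_eq_C_mul _
  have hlast : u (Fin.last d) = 0 := by
    have := congrFun hw0 k
    simpa [hw, hk, hb] using this
  ext l
  simpa [hw, hlast] using congrFun hw0 l

theorem sum_two_mul_perm (n : ℕ) (σ : Equiv.Perm (Fin n)) :
    ∑ i, 2 * (σ i : ℕ) = n * (n - 1) := by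
  rw [Equiv.sum_comp σ fun i : Fin n => 2 * (i : ℕ), ← Finset.mul_sum,
    Fin.sum_univ_eq_sum_range fun i => i, mul_comm, Finset.sum_range_id_mul_two]

open MvPolynomial in
theorem prod_X_sq_pow_perm {R : Type*} [CommRing R] {n : ℕ} (σ : Equiv.Perm (Fin n)) :
    ∏ i, (X i ^ 2 : MvPolynomial (Fin n) R) ^ (σ i : ℕ) =
      monomial (Finsupp.equivFunOnFinite.symm fun i => 2 * (σ i : ℕ)) 1 := by
  rw [monomial_eq, C_1, one_mul, Finsupp.prod_fintype _ _ fun i => pow_zero _]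
  simp [pow_mul]

open MvPolynomial in
theorem isHomogeneous_det_vandermonde_X_sq (R : Type*) [CommRing R] (n : ℕ) :
    (Matrix.vandermonde fun i : Fin n => (X i ^ 2 : MvPolynomial (Fin n) R)).det.IsHomogeneous
      (n * (n - 1)) := by
  rw [← Matrix.det_transpose, Matrix.det_apply]
  refine IsHomogeneous.sum _ _ _ fun σ _ => ?_
  simp only [Matrix.transpose_apply, Matrix.vandermonde_apply, prod_X_sq_pow_perm]
  rw [Units.smul_def]
  refine Submodule.smul_of_tower_mem (homogeneousSubmodule (Fin n) R (n * (n - 1))) _ ?_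
  refine isHomogeneous_monomial _ ?_
  simpa [Finsupp.degree_eq_sum] using sum_two_mul_perm n σ

open MvPolynomial in
theorem coeff_prod_X_sq_pow_perm_mul {F : Type*} [Field F] {n m : ℕ} (hm : (m.factorial : F) ≠ 0)
    (σ : Equiv.Perm (Fin n)) (c : Fin n →₀ ℕ) (hc : c.degree = n * (n - 1) + m) :
    coeff c ((∏ i, (X i ^ 2 : MvPolynomial (Fin n) F) ^ (σ i : ℕ)) * (∑ i, X i) ^ m) =
      m.factorial *
        ∏ i, if 2 * (σ i : ℕ) ≤ c i then (((c i - 2 * σ i).factorial : ℕ) : F)⁻¹ else 0 := by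
  rw [prod_X_sq_pow_perm, coeff_monomial_mul', one_mul]
  split_ifs with h
  · have h' (i : Fin n) : 2 * (σ i : ℕ) ≤ c i := h i
    have hsum : ∑ i, (c i - 2 * (σ i : ℕ)) = m := by
      have := sum_two_mul_perm n σ
      rw [Finsupp.degree_eq_sum] at hc
      rw [Finset.sum_tsub_distrib _ fun i _ => h' i]
      lia
    rw [coeff_sum_X_pow_of_fintype, if_pos (by rw [Finsupp.sum_fintype _ _ fun _ => rfl]; simpa)]
    simp only [h', if_true, Finset.prod_inv_distrib]
    have hspec := Nat.multinomial_spec Finset.univ fun i => c i - 2 * (σ i : ℕ)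
    rw [hsum] at hspec
    have hmul : Finsupp.multinomial (c - Finsupp.equivFunOnFinite.symm fun i => 2 * (σ i : ℕ)) =
        Nat.multinomial Finset.univ fun i => c i - 2 * (σ i : ℕ) := by
      rw [Finsupp.multinomial_eq_of_support_subset (Finset.subset_univ _)]
      rfl
    rw [← hspec] at hm ⊢
    push_cast at hm ⊢
    rw [hmul]
    have := left_ne_zero_of_mul hm
    field_simp
  · obtain ⟨i, hi⟩ : ∃ i, ¬ 2 * (σ i : ℕ) ≤ c i := by
      by_contra! h'
      exact h h'
    rw [Finset.prod_eq_zero (Finset.mem_univ i) (if_neg hi), mul_zero]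

/-- The matrix of inverse factorials `1 / (c i - 2 * j)!`, with zeros where `c i < 2 * j`. -/
def invFactorialMatrix (F : Type*) [Field F] {n : ℕ} (c : Fin n → ℕ) : Matrix (Fin n) (Fin n) F :=
  Matrix.of fun i j => if 2 * (j : ℕ) ≤ c i then (((c i - 2 * j).factorial : ℕ) : F)⁻¹ else 0

open MvPolynomial in
theorem coeff_det_vandermonde_X_sq_mul {F : Type*} [Field F] {n m : ℕ}
    (hm : (m.factorial : F) ≠ 0) (c : Fin n →₀ ℕ) (hc : c.degree = n * (n - 1) + m) :
    coeff c ((Matrix.vandermonde fun i : Fin n => (X i ^ 2 : MvPolynomial (Fin n) F)).det *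
      (∑ i, X i) ^ m) = m.factorial * (invFactorialMatrix F c).det := by
  rw [← Matrix.det_transpose, Matrix.det_apply, ← Matrix.det_transpose (invFactorialMatrix F c),
    Matrix.det_apply, Finset.sum_mul, coeff_sum, Finset.mul_sum]
  refine Finset.sum_congr rfl fun σ _ => ?_
  simp only [Matrix.transpose_apply, Matrix.vandermonde_apply, invFactorialMatrix, Matrix.of_apply]
  rw [smul_mul_assoc, Units.smul_def, Units.smul_def, coeff_smul,
    coeff_prod_X_sq_pow_perm_mul hm σ c hc, mul_smul_comm]

open MvPolynomial in
theorem coeff_mul_aeval_of_isHomogeneous {R σ : Type*} [CommRing R] {H L : MvPolynomial σ R}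
    {D m : ℕ} (hH : H.IsHomogeneous D) (hL : L.IsHomogeneous 1) {Q : Polynomial R}
    (hQ : Q.Monic) (hQm : Q.natDegree = m) {c : σ →₀ ℕ} (hc : c.degree = D + m) :
    coeff c (H * Polynomial.aeval L Q) = coeff c (H * L ^ m) := by
  rw [Polynomial.aeval_eq_sum_range, hQm, Finset.mul_sum, coeff_sum, Finset.sum_range_succ,
    Finset.sum_eq_zero, zero_add, ← hQm, hQ.coeff_natDegree, one_smul]
  intro k hk
  have hk : k < m := Finset.mem_range.mp hk
  rw [mul_smul_comm, coeff_smul, (hH.mul (by simpa using hL.pow k)).coeff_eq_zero (by lia),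
    smul_zero]

open MvPolynomial in
theorem totalDegree_mul_aeval_le {R σ : Type*} [CommRing R] {H L : MvPolynomial σ R}
    {D m : ℕ} (hH : H.IsHomogeneous D) (hL : L.IsHomogeneous 1) {Q : Polynomial R}
    (hQm : Q.natDegree = m) : (H * Polynomial.aeval L Q).totalDegree ≤ D + m := by
  rw [Polynomial.aeval_eq_sum_range, hQm, Finset.mul_sum]
  refine totalDegree_finsetSum_le fun k hk => ?_
  have hk : k < m + 1 := Finset.mem_range.mp hk
  rw [mul_smul_comm]
  refine (totalDegree_smul_le _ _).trans ((hH.mul (hL.pow k)).totalDegree_le.trans (by lia))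

open MvPolynomial in
/-- A polynomial method criterion for a sum of elements with distinct squares to avoid the roots
of a monic polynomial. -/
theorem exists_injective_sq_eval_sum_ne_zero {F : Type*} [Field F] {n m : ℕ}
    (hm : (m.factorial : F) ≠ 0) (c : Fin n → ℕ) (hc : ∑ i, c i = n * (n - 1) + m)
    (hdet : (invFactorialMatrix F c).det ≠ 0) {Q : Polynomial F} (hQ : Q.Monic)
    (hQm : Q.natDegree = m) (S : Fin n → Finset F) (hS : ∀ i, c i < (S i).card) :
    ∃ x : Fin n → F, (∀ i, x i ∈ S i) ∧ (Function.Injective fun i => x i ^ 2) ∧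
      Q.eval (∑ i, x i) ≠ 0 := by
  set V := (Matrix.vandermonde fun i : Fin n => (X i ^ 2 : MvPolynomial (Fin n) F)).det with hV
  set L : MvPolynomial (Fin n) F := ∑ i, X i with hL
  set t : Fin n →₀ ℕ := Finsupp.equivFunOnFinite.symm c with ht
  have htd : t.degree = n * (n - 1) + m := by simpa [Finsupp.degree_eq_sum, ht] using hc
  have hV' := isHomogeneous_det_vandermonde_X_sq F n
  have hL' : L.IsHomogeneous 1 := IsHomogeneous.sum _ _ _ fun i _ => isHomogeneous_X F i
  have hcoeff : coeff t (V * Polynomial.aeval L Q) ≠ 0 := by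
    rw [coeff_mul_aeval_of_isHomogeneous hV' hL' hQ hQm htd,
      coeff_det_vandermonde_X_sq_mul hm t htd]
    exact mul_ne_zero hm hdet
  obtain ⟨x, hxS, hx⟩ := combinatorial_nullstellensatz_exists_eval_nonzero _ t hcoeff
    (le_antisymm ((totalDegree_mul_aeval_le hV' hL' hQm).trans_eq htd.symm)
      (le_totalDegree (mem_support_iff.mpr hcoeff))) S hS
  rw [map_mul] at hx
  refine ⟨x, hxS, Matrix.det_vandermonde_ne_zero_iff.mp fun h => left_ne_zero_of_mul hx ?_,
    fun h => right_ne_zero_of_mul hx ?_⟩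
  · rw [hV, RingHom.map_det, ← h]
    congr 1
    ext i j
    simp [Matrix.vandermonde_apply]
  · rw [← h, Polynomial.aeval_def, Polynomial.hom_eval₂, hL]
    have hid : (eval x).comp C = RingHom.id F := by
      ext
      simp
    simp [hid, Polynomial.eval₂_id]

theorem invFactorialMatrix_succAbove_det_ne_zero {F : Type*} [Field F] {d : ℕ}
    (hd : ((2 * d).factorial : F) ≠ 0) (k : Fin (d + 1)) :
    (invFactorialMatrix F fun i : Fin d => 2 * d - 1 - (k.succAbove i : ℕ)).det ≠ 0 := by
  intro hdet
  obtain ⟨v, hv, hv0⟩ := Matrix.exists_vecMul_eq_zero_iff.mpr hdet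
  refine hv ?_
  have hu := eq_zero_of_forall_sum_descFactorial_odd hd (k.insertNth 0 v) k (by simp) ?_
  · ext i
    simpa using congrFun hu (k.succAbove i)
  intro j hj
  have hentry (i : Fin d) : ((2 * j + 1).descFactorial (k.succAbove i) : F) =
      (2 * j + 1).factorial * invFactorialMatrix F
        (fun i : Fin d => 2 * d - 1 - (k.succAbove i : ℕ)) i ⟨d - 1 - j, by lia⟩ := by
    have hi := (k.succAbove i).isLt
    simp only [invFactorialMatrix, Matrix.of_apply]
    split_ifs with h
    · rw [show 2 * d - 1 - (k.succAbove i : ℕ) - 2 * (d - 1 - j) =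
        2 * j + 1 - k.succAbove i by lia]
      have hle : (k.succAbove i : ℕ) ≤ 2 * j + 1 := by lia
      rw [eq_mul_inv_iff_mul_eq₀, mul_comm, ← Nat.cast_mul, Nat.factorial_mul_descFactorial hle]
      intro h0
      obtain ⟨c, hc⟩ := Nat.factorial_dvd_factorial
        (show 2 * j + 1 - (k.succAbove i : ℕ) ≤ 2 * d by lia)
      exact hd (by rw [hc, Nat.cast_mul, h0, zero_mul])
    · rw [Nat.descFactorial_eq_zero_iff_lt.mpr (by lia), Nat.cast_zero, mul_zero]
  have hj0 := congrFun hv0 ⟨d - 1 - j, by lia⟩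
  simp only [Matrix.vecMul, dotProduct, Pi.zero_apply] at hj0
  rw [Fin.sum_univ_succAbove _ k]
  simp only [Fin.insertNth_apply_same, Fin.insertNth_apply_succAbove, zero_mul, zero_add, hentry]
  rw [Finset.sum_congr rfl fun i _ => mul_left_comm _ _ _, ← Finset.mul_sum, hj0, mul_zero]

theorem ZMod.factorial_ne_zero {p : ℕ} (hp : p.Prime) {n : ℕ} (hn : n < p) :
    (n.factorial : ZMod p) ≠ 0 := by
  rw [Ne, ZMod.natCast_eq_zero_iff, hp.dvd_factorial]
  lia

theorem card_union_neg_and_two_mul_card_lt {p : ℕ} [NeZero p] {A : Finset (ZMod p)}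
    (hA : ∀ a ∈ A, -a ∉ A) : (A ∪ A.image Neg.neg).card = 2 * A.card ∧ 2 * A.card < p := by
  have hcard : (A ∪ A.image Neg.neg).card = 2 * A.card := by
    rw [Finset.card_union_of_disjoint, Finset.card_image_of_injective _ neg_injective, two_mul]
    rw [Finset.disjoint_left]
    intro a ha ha'
    obtain ⟨b, hb, rfl⟩ := Finset.mem_image.mp ha'
    exact hA b hb ha
  refine ⟨hcard, ?_⟩
  have h0 : (0 : ZMod p) ∉ A := fun h => hA 0 h (by simpa using h)
  have hlt := Finset.card_lt_univ_of_notMem (s := A ∪ A.image Neg.neg) (x := 0) (by simp [h0])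
  rwa [hcard, ZMod.card] at hlt

theorem sum_sub_succAbove {d T : ℕ} (hT : 2 * T = d * (d - 1)) (k : Fin (d + 1)) (hd : 0 < d) :
    ∑ i, (2 * d - 1 - (k.succAbove i : ℕ)) = d * (d - 1) + (T + k) := by
  have hsplit := Fin.sum_univ_succAbove (fun l : Fin (d + 1) => 2 * d - 1 - (l : ℕ)) k
  have hrefl : ∑ l : Fin (d + 1), (2 * d - 1 - (l : ℕ)) + ∑ l : Fin (d + 1), (l : ℕ) =
      (d + 1) * (2 * d - 1) := by
    rw [← Finset.sum_add_distrib, Finset.sum_congr rfl fun l _ => Nat.sub_add_cancel (by lia)]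
    simp
  have hgauss : (∑ l : Fin (d + 1), (l : ℕ)) * 2 = (d + 1) * d := by
    rw [Fin.sum_univ_eq_sum_range fun l => l, Finset.sum_range_id_mul_two, Nat.add_sub_cancel]
  have hk := k.isLt
  obtain ⟨e, rfl⟩ := Nat.exists_eq_add_of_lt hd
  simp only [zero_add, Nat.add_sub_cancel] at *
  rw [show 2 * (e + 1) - 1 = 2 * e + 1 by lia] at *
  have hk' : 2 * e + 1 - (k : ℕ) + k = 2 * e + 1 := by lia
  nlinarith

/-- In an abelian group, if each `x i` is `g i` or `-g i` and the sum of the `x i` is the opposite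
of the sum of the `g i`, then twice the sum of the `g i` with `x i = g i` vanishes. -/
theorem two_mul_sum_filter_eq_zero {R ι : Type*} [CommRing R] [DecidableEq R] [Fintype ι]
    {x g : ι → R} (hx : ∀ i, x i = g i ∨ x i = -g i) (hsum : ∑ i, x i + ∑ i, g i = 0) :
    2 * ∑ i with x i = g i, g i = 0 := by
  rw [← hsum, ← Finset.sum_add_distrib, Finset.sum_filter, Finset.mul_sum]
  refine Finset.sum_congr rfl fun i _ => ?_
  split_ifs with h
  · rw [h, two_mul]
  · rw [(hx i).resolve_left h]
    simp

open Polynomial in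
theorem exists_nonempty_subset_sum_eq_zero {p : ℕ} (hp : p.Prime) {A : Finset (ZMod p)}
    (hA : ∀ a ∈ A, -a ∉ A) {T k : ℕ} (hT : 2 * T = A.card * (A.card - 1)) (hk : k < A.card)
    (hpT : p = T + k + 1) : ∃ B ⊆ A, B.Nonempty ∧ ∑ b ∈ B, b = 0 := by
  have : Fact p.Prime := ⟨hp⟩
  obtain ⟨hcard, hlt⟩ := card_union_neg_and_two_mul_card_lt hA
  obtain ⟨d, hd⟩ : ∃ d, A.card = d + 1 := ⟨A.card - 1, by lia⟩
  rw [hd] at hT hk hcard hlt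
  set K : Fin (d + 1 + 1) := ⟨k, by lia⟩ with hK
  set S : Fin (d + 1) → Finset (ZMod p) := fun i =>
    if i = Fin.last d then A else A ∪ A.image Neg.neg with hS
  have hS_sub (i) : S i ⊆ A ∪ A.image Neg.neg := by
    simp only [hS]
    split_ifs
    exacts [Finset.subset_union_left, subset_rfl]
  have hS_card (i) : 2 * (d + 1) - 1 - (K.succAbove i : ℕ) < (S i).card := by
    simp only [hS]
    split_ifs with hi
    · have : K.succAbove (Fin.last d) = Fin.last (d + 1) :=
        Fin.succAbove_of_le_castSucc _ _ (Fin.mk_le_of_le_val (by simp; lia))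
      rw [hi, this, hd, Fin.val_last]
      lia
    · lia
  have hm : T + k ≠ 0 := by
    have := hp.two_le
    lia
  have hQdeg : ((X + C (∑ a ∈ A, a)) ^ (T + k) : (ZMod p)[X]).natDegree = T + k :=
    natDegree_pow_X_add_C _ _
  have hQm : ((X + C (∑ a ∈ A, a)) ^ (T + k) - 1 : (ZMod p)[X]).natDegree = T + k := by
    rw [natDegree_sub_eq_left_of_natDegree_lt, hQdeg]
    rw [hQdeg, natDegree_one]
    lia
  have hQ : ((X + C (∑ a ∈ A, a)) ^ (T + k) - 1 : (ZMod p)[X]).Monic := by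
    refine ((monic_X_add_C _).pow _).sub_of_left ?_
    refine degree_lt_degree ?_
    rw [hQdeg, natDegree_one]
    lia
  obtain ⟨x, hxS, hxinj, hx⟩ := exists_injective_sq_eval_sum_ne_zero
    (ZMod.factorial_ne_zero hp (by lia)) _ (sum_sub_succAbove hT K (by lia))
    (invFactorialMatrix_succAbove_det_ne_zero (ZMod.factorial_ne_zero hp hlt) K) hQ hQm S hS_card
  have hsum : ∑ i, x i + ∑ a ∈ A, a = 0 := by
    by_contra h
    refine hx ?_
    simp only [eval_sub, eval_pow, eval_add, eval_X, eval_C, eval_one]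
    rw [show T + k = p - 1 by lia, ZMod.pow_card_sub_one_eq_one h, sub_self]
  have hex (i) : ∃ a ∈ A, x i = a ∨ x i = -a := by
    rcases Finset.mem_union.mp (hS_sub i (hxS i)) with h | h
    · exact ⟨x i, h, Or.inl rfl⟩
    · obtain ⟨a, ha, hax⟩ := Finset.mem_image.mp h
      exact ⟨a, ha, Or.inr hax.symm⟩
  choose g hgA hg using hex
  have hginj : Function.Injective g := fun i j hij => hxinj <| by
    have hsq (l) : x l ^ 2 = g l ^ 2 := sq_eq_sq_iff_eq_or_eq_neg.mpr (hg l)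
    simp only [hsq, hij]
  have hgimage : Finset.univ.image g = A :=
    Finset.eq_of_subset_of_card_le (by simpa [Finset.subset_iff] using hgA)
      (by rw [Finset.card_image_of_injective _ hginj, hd]; simp)
  rw [← hgimage, Finset.sum_image hginj.injOn] at hsum
  have hzero := two_mul_sum_filter_eq_zero hg hsum
  have htwo : (2 : ZMod p) ≠ 0 := by
    simpa using ZMod.factorial_ne_zero hp (show 2 < p by lia)
  refine ⟨({i | x i = g i} : Finset (Fin (d + 1))).image g, ?_, ?_, ?_⟩
  · exact (Finset.image_subset_image (Finset.filter_subset _ _)).trans hgimage.subset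
  · refine ⟨g (Fin.last d), Finset.mem_image_of_mem g ?_⟩
    refine Finset.mem_filter.mpr ⟨Finset.mem_univ _, (hg _).resolve_right fun h => ?_⟩
    have hlast : x (Fin.last d) ∈ A := by simpa [hS] using hxS (Fin.last d)
    exact hA _ (hgA (Fin.last d)) (h ▸ hlast)
  · rw [Finset.sum_image hginj.injOn]
    exact (mul_eq_zero.mp hzero).resolve_left htwo

theorem exists_nonempty_zero_sum_subset (p : ℕ) (hp : p.Prime) (A : Finset (ZMod p))
    (hne : A.Nonempty) (hA : ∀ a ∈ A, -a ∉ A) (hbig : p ≤ A.card * (A.card + 1) / 2) :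
    (0 : ZMod p) ∈ (A.powerset.filter fun S => S.Nonempty).image fun S => S.sum id := by
  have hex : ∃ d, p ≤ d * (d + 1) / 2 := ⟨_, hbig⟩
  obtain ⟨A', hA'A, hA'⟩ := Finset.exists_subset_card_eq (Nat.find_min' hex hbig)
  have hle := Nat.find_spec hex
  have hmin (e : ℕ) (he : e < A'.card) : e * (e + 1) / 2 < p := by
    rw [hA'] at he
    exact not_le.mp (Nat.find_min hex he)
  rw [← hA'] at hle
  obtain ⟨e, he⟩ : ∃ e, A'.card = e + 1 := by
    refine Nat.exists_eq_succ_of_ne_zero fun h => ?_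
    have := hp.two_le
    simp [h] at hle
    lia
  have hlt := hmin e (by lia)
  have heven : 2 * (e * (e + 1) / 2) = e * (e + 1) :=
    Nat.mul_div_cancel' (Nat.even_mul_succ_self e).two_dvd
  rw [he, Nat.le_div_iff_mul_le two_pos] at hle
  have hk : p - 1 - e * (e + 1) / 2 < A'.card := by
    rw [he]
    have : (e + 1) * (e + 1 + 1) = e * (e + 1) + 2 * (e + 1) := by ring
    lia
  obtain ⟨B, hBA, hB, hsum⟩ := exists_nonempty_subset_sum_eq_zero hp
    (fun a ha h => hA a (hA'A ha) (hA'A h)) (T := e * (e + 1) / 2) (k := p - 1 - e * (e + 1) / 2)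
    (by rw [heven, he, Nat.add_sub_cancel, mul_comm]) hk (by lia)
  exact Finset.mem_image.mpr
    ⟨B, Finset.mem_filter.mpr ⟨Finset.mem_powerset.mpr (hBA.trans hA'A), hB⟩, hsum⟩
end
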